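/- There is a universal constant c > 0 with the following property. Let n ≥ 2, let K ⊆ ℝⁿ be a convex body with 0 in its interior, and let ε > 0. Suppose that for every 2-dimensional linear subspace E ⊆ ℝⁿ there exist an invertible affine map T : ℝ² → E and z ∈ E with K ∩ E ⊆ T(B²) ⊆ (1 + ε)·(K ∩ E) + z, where B² is the closed Euclidean unit disc. Then there exist an invertible affine map T : ℝⁿ → ℝⁿ and z ∈ ℝⁿ with K ⊆ T(Bⁿ) ⊆ (1 + c·n^{2n²}·√ε)·K + z, where Bⁿ is the closed Euclidean unit ball. -/

import Mathlib

open Set Metric Pointwise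

/-- The quadratic function whose sublevel set at `0` is the elliptic disc with centre `x₀`. -/
noncomputable def conic {V : Type*} [AddCommGroup V] [Module ℝ V]
    (L : V →ₗ[ℝ] EuclideanSpace ℝ (Fin 2)) (x₀ x : V) : ℝ :=
  ‖L (x - x₀)‖ ^ 2 - 1

/-- The section of `K` by the subspace `F` is `ε`-close to an elliptic disc. -/
def PlaneFit {V : Type*} [AddCommGroup V] [Module ℝ V] (K : Set V) (ε : ℝ)
    (F : Submodule ℝ V) : Prop :=
  ∃ (L : V →ₗ[ℝ] EuclideanSpace ℝ (Fin 2)) (x₀ k₀ : V), x₀ ∈ F ∧ k₀ ∈ K ∧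
    (∀ x ∈ K, x ∈ F → ‖L (x - x₀)‖ ≤ 1) ∧
    (∀ x ∈ F, ‖L (x - x₀)‖ ≤ 1 → ∃ k ∈ K, x = (1 + ε) • k - ε • k₀)

/-- Quantitative facts about an elliptic disc close to a section of `K`; `A` bounds the
eccentricity of everything in sight. -/
structure DeepFit {V : Type*} [NormedAddCommGroup V] [NormedSpace ℝ V] (K : Set V) (A ε : ℝ)
    (F : Submodule ℝ V) (L : V →ₗ[ℝ] EuclideanSpace ℝ (Fin 2)) (x₀ : V) : Prop where
  center_mem : x₀ ∈ F
  conic_nonpos : ∀ x ∈ K, x ∈ F → conic L x₀ x ≤ 0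
  upper : ∀ y ∈ F, ‖L y‖ ≤ A * ‖y‖
  lower : ∀ y ∈ F, ‖y‖ ≤ 2 * ‖L y‖
  shrink : ∀ v ∈ F, closedBall v (3 / A) ⊆ K → ∀ x ∈ F, conic L x₀ x ≤ 0 →
    v + (1 + A * ε)⁻¹ • (x - v) ∈ K
  deep : ∀ v ∈ F, closedBall v (3 / A) ⊆ K → conic L x₀ v ≤ -(2 / A)

section Fit

variable {V : Type*} [NormedAddCommGroup V] [NormedSpace ℝ V]

lemma conic_nonpos_iff {L : V →ₗ[ℝ] EuclideanSpace ℝ (Fin 2)} {x₀ x : V} :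
    conic L x₀ x ≤ 0 ↔ ‖L (x - x₀)‖ ≤ 1 := by
  unfold conic
  rw [sub_nonpos, sq_le_one_iff₀ (norm_nonneg _)]

lemma PlaneFit.exists_deepFit {K : Set V} (hK : Convex ℝ K) (hK1 : K ⊆ closedBall 0 1)
    {A ε : ℝ} (hA : 100 ≤ A) (hε : 0 < ε) (hε1 : ε ≤ 1 / 2) {F : Submodule ℝ V}
    (h : PlaneFit K ε F) {u : V} (hu : u ∈ F) (huK : closedBall u (3 / A) ⊆ K) :
    ∃ L x₀, DeepFit K A ε F L x₀ := by
  obtain ⟨L, x₀, k₀, hx₀, hk₀, hin, hout⟩ := h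
  have hA0 : 0 < A := by linarith
  have hr : 0 < 3 / A := by positivity
  have hKn : ∀ x ∈ K, ‖x‖ ≤ 1 := fun x hx => by simpa using hK1 hx
  have hupper : ∀ y ∈ F, ‖L y‖ ≤ A * ‖y‖ := by
    intro y hy
    rcases eq_or_ne y 0 with rfl | hy0
    · simp
    have hyn : 0 < ‖y‖ := norm_pos_iff.2 hy0
    set t := (3 / A) / ‖y‖ with ht
    have ht0 : 0 < t := by positivity
    have hty : ‖t • y‖ ≤ 3 / A := by
      rw [norm_smul, Real.norm_of_nonneg ht0.le, ht, div_mul_cancel₀ _ hyn.ne']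
    have h1 := hin (u + t • y) (huK (by simpa [mem_closedBall, dist_eq_norm] using hty))
      (F.add_mem hu (F.smul_mem _ hy))
    have h2 := hin (u - t • y) (huK (by simpa [mem_closedBall, dist_eq_norm] using hty))
      (F.sub_mem hu (F.smul_mem _ hy))
    have h3 : L (t • y) = (1 / 2 : ℝ) • (L (u + t • y - x₀) - L (u - t • y - x₀)) := by
      rw [← map_sub, ← map_smul]; congr 1; module
    have h4 : ‖L (t • y)‖ ≤ 1 := by
      rw [h3, norm_smul]
      have := norm_sub_le (L (u + t • y - x₀)) (L (u - t • y - x₀))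
      rw [Real.norm_of_nonneg (by norm_num)]
      linarith
    rw [map_smul, norm_smul, Real.norm_of_nonneg ht0.le, ht] at h4
    have h5 : ‖L y‖ * 3 ≤ A * ‖y‖ := by
      have : 3 / A / ‖y‖ * ‖L y‖ = (‖L y‖ * 3) / (A * ‖y‖) := by field_simp
      rw [this, div_le_one (by positivity)] at h4
      exact h4
    nlinarith [norm_nonneg (L y)]
  have hDn : ∀ x ∈ F, ‖L (x - x₀)‖ ≤ 1 → ‖x‖ ≤ 2 := by
    intro x hx hx1
    obtain ⟨k, hk, rfl⟩ := hout x hx hx1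
    refine (norm_sub_le _ _).trans ?_
    rw [norm_smul, norm_smul, Real.norm_of_nonneg hε.le,
      Real.norm_of_nonneg (by linarith : (0:ℝ) ≤ 1 + ε)]
    nlinarith [hKn k hk, hKn k₀ hk₀]
  have hlower1 : ∀ y ∈ F, ‖L y‖ ≤ 1 → ‖y‖ ≤ 2 := by
    intro y hy hy1
    have h1 := hDn (x₀ + y) (F.add_mem hx₀ hy) (by simpa using hy1)
    have h2 := hDn (x₀ - y) (F.sub_mem hx₀ hy) (by simpa using hy1)
    have h3 : y = (1 / 2 : ℝ) • ((x₀ + y) - (x₀ - y)) := by module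
    rw [h3, norm_smul]
    have := norm_sub_le (x₀ + y) (x₀ - y)
    norm_num at this ⊢
    linarith
  have hlower : ∀ y ∈ F, ‖y‖ ≤ 2 * ‖L y‖ := by
    intro y hy
    rcases eq_or_lt_of_le (norm_nonneg (L y)) with h0 | h0
    · by_contra hcon
      have hyn : 0 < ‖y‖ := by rw [← h0] at hcon; simpa using hcon
      have := hlower1 ((3 / ‖y‖) • y) (F.smul_mem _ hy) (by
        rw [map_smul, norm_smul, ← h0]; simp)
      rw [norm_smul, Real.norm_of_nonneg (by positivity), div_mul_cancel₀ _ hyn.ne'] at this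
      norm_num at this
    · have := hlower1 (‖L y‖⁻¹ • y) (F.smul_mem _ hy) (by
        rw [map_smul, norm_smul, norm_inv, norm_norm, inv_mul_cancel₀ h0.ne'])
      rw [norm_smul, norm_inv, norm_norm, inv_mul_le_iff₀ h0] at this
      linarith
  refine ⟨L, x₀, hx₀, fun x hx hxF => conic_nonpos_iff.2 (hin x hx hxF), hupper, hlower, ?_, ?_⟩
  · intro v hv hvK x hx hx1
    obtain ⟨k, hk, rfl⟩ := hout x hx (conic_nonpos_iff.1 hx1)
    have hvK' : v ∈ K := hvK (mem_closedBall_self hr.le)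
    set τ := 3 / (2 * A) with hτ
    have hτ0 : 0 < τ := by positivity
    have hk1 : v - τ • (k₀ - v) ∈ K := by
      apply hvK
      rw [mem_closedBall, dist_eq_norm, sub_sub_cancel_left, norm_neg, norm_smul,
        Real.norm_of_nonneg hτ0.le]
      have : ‖k₀ - v‖ ≤ 2 := (norm_sub_le _ _).trans (by linarith [hKn _ hk₀, hKn _ hvK'])
      calc τ * ‖k₀ - v‖ ≤ τ * 2 := by gcongr
        _ = 3 / A := by rw [hτ]; field_simp
    have hAε : 0 < 1 + A * ε := by positivity
    have hw1 : 0 ≤ (1 + A * ε)⁻¹ * (1 + ε) := by positivity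
    have hw2 : 0 ≤ (1 + A * ε)⁻¹ * (2 * A * ε / 3) := by positivity
    have hw3 : 0 ≤ (1 + A * ε)⁻¹ * (A * ε / 3 - ε) := by
      apply mul_nonneg (by positivity); nlinarith
    have hsum : (1 + A * ε)⁻¹ * (1 + ε) + (1 + A * ε)⁻¹ * (2 * A * ε / 3) +
        (1 + A * ε)⁻¹ * (A * ε / 3 - ε) = 1 := by field_simp; ring
    have key := hK.sum_mem (t := Finset.univ) (w := ![(1 + A * ε)⁻¹ * (1 + ε),
      (1 + A * ε)⁻¹ * (2 * A * ε / 3), (1 + A * ε)⁻¹ * (A * ε / 3 - ε)])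
      (z := ![k, v - τ • (k₀ - v), v])
      (by intro i _; fin_cases i <;> simpa using by assumption)
      (by simpa [Fin.sum_univ_three] using hsum)
      (by intro i _; fin_cases i <;> simpa using by assumption)
    rw [Fin.sum_univ_three] at key
    simp only [Matrix.cons_val_zero, Matrix.cons_val_one, Matrix.cons_val_two, Matrix.head_cons,
      Matrix.tail_cons] at key
    convert key using 1
    rw [hτ]
    match_scalars <;> field_simp
    ring
  · intro v hv hvK
    unfold conic
    set N := ‖L (v - x₀)‖ with hN
    have hN0 : 0 ≤ N := norm_nonneg _
    have hA1 : 2 / A ≤ 1 := by rw [div_le_one hA0]; linarith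
    rcases eq_or_ne v x₀ with rfl | hne
    · have : N = 0 := by simp [hN]
      rw [this]; linarith
    have hd : 0 < ‖v - x₀‖ := norm_pos_iff.2 (sub_ne_zero.2 hne)
    have hvF := F.sub_mem hv hx₀
    set t := (3 / A) / ‖v - x₀‖ with ht
    have ht0 : 0 < t := by positivity
    have h1 := hin (v + t • (v - x₀)) (by
      apply hvK
      rw [mem_closedBall, dist_eq_norm, add_sub_cancel_left, norm_smul,
        Real.norm_of_nonneg ht0.le, ht, div_mul_cancel₀ _ hd.ne']) (F.add_mem hv (F.smul_mem _ hvF))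
    have h2 : v + t • (v - x₀) - x₀ = (1 + t) • (v - x₀) := by module
    rw [h2, map_smul, norm_smul, Real.norm_of_nonneg (by linarith), ← hN] at h1
    have hN1 : N ≤ 1 := by nlinarith
    have h3 : ‖v - x₀‖ ≤ 2 := (hlower _ hvF).trans (by linarith)
    have h4 : 3 / (2 * A) ≤ t := by
      rw [ht, div_div, mul_comm 2 A]; gcongr
    set q := 3 / (2 * A) with hq
    have hq0 : 0 < q := by positivity
    have h5 : (1 + q) * N ≤ 1 := le_trans (by gcongr) h1
    have h6 : 2 / A = 4 / 3 * q := by rw [hq]; field_simp; norm_num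
    have hq1 : q ≤ 3 / 200 := by rw [hq]; gcongr; linarith
    rw [h6]
    have h7 : (1 + q) ^ 2 * N ^ 2 ≤ 1 := by nlinarith [mul_nonneg hq0.le hN0]
    have h8 : 1 ≤ (1 + q) ^ 2 * (1 - 4 / 3 * q) := by nlinarith [mul_pos hq0 hq0]
    nlinarith [sq_nonneg (1 + q), mul_pos hq0 hq0]

end Fit

section Fit

variable {V : Type*} [NormedAddCommGroup V] [NormedSpace ℝ V]

lemma exists_ray_endpoint {K : Set V} (hK : IsCompact K) (h0 : (0 : V) ∈ K) {u : V}
    (hu : u ≠ 0) : ∃ t : ℝ, 0 ≤ t ∧ t • u ∈ K ∧ ∀ s, t < s → s • u ∉ K := by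
  set S : Set ℝ := (fun t : ℝ => t • u) ⁻¹' K with hS
  have hemb : Topology.IsClosedEmbedding (fun t : ℝ => t • u) := isClosedEmbedding_smul_left hu
  have hSc : IsCompact S := hemb.isCompact_preimage hK
  have h0S : (0 : ℝ) ∈ S := by simpa [hS] using h0
  obtain ⟨t, htS, ht⟩ := hSc.exists_isGreatest ⟨0, h0S⟩
  exact ⟨t, ht h0S, htS, fun s hs hsK => absurd (ht hsK) (not_le.2 hs)⟩

/-- A choice of parameters at which the line through `0` and `u` leaves `K`, on the two sides. -/
structure LineEnds (K : Set V) (u : V) (a b : ℝ) : Prop where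
  a_nonneg : 0 ≤ a
  b_nonneg : 0 ≤ b
  a_mem : -(a • u) ∈ K
  b_mem : b • u ∈ K
  a_max : ∀ s, a < s → -(s • u) ∉ K
  b_max : ∀ s, b < s → s • u ∉ K

lemma exists_lineEnds {K : Set V} (hK : IsCompact K) (h0 : (0 : V) ∈ K) {u : V}
    (hu : u ≠ 0) : ∃ a b : ℝ, LineEnds K u a b := by
  obtain ⟨b, hb0, hb, hb'⟩ := exists_ray_endpoint hK h0 hu
  obtain ⟨a, ha0, ha, ha'⟩ := exists_ray_endpoint hK h0 (neg_ne_zero.2 hu)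
  exact ⟨a, b, ha0, hb0, by simpa using ha, hb, by simpa using ha', hb'⟩

lemma conic_add (L : V →ₗ[ℝ] EuclideanSpace ℝ (Fin 2)) (x₀ x h : V) :
    conic L x₀ (x + h) = conic L x₀ x + 2 * inner ℝ (L (x - x₀)) (L h) + ‖L h‖ ^ 2 := by
  unfold conic
  rw [show x + h - x₀ = (x - x₀) + h by abel, map_add, norm_add_sq_real]
  ring

lemma conic_add_le {L : V →ₗ[ℝ] EuclideanSpace ℝ (Fin 2)} {x₀ x : V}
    (hx : conic L x₀ x ≤ 0) (h : V) :
    conic L x₀ (x + h) ≤ conic L x₀ x + 2 * ‖L h‖ + ‖L h‖ ^ 2 := by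
  rw [conic_add]
  have h1 := real_inner_le_norm (L (x - x₀)) (L h)
  have h2 := conic_nonpos_iff.1 hx
  nlinarith [norm_nonneg (L h)]

lemma conic_convex (L : V →ₗ[ℝ] EuclideanSpace ℝ (Fin 2)) (x₀ x y : V) {s t : ℝ} (hs : 0 ≤ s)
    (ht : 0 ≤ t) (hst : s + t = 1) :
    conic L x₀ (s • x + t • y) ≤ s * conic L x₀ x + t * conic L x₀ y := by
  unfold conic
  obtain rfl : s = 1 - t := by linarith
  have h1 : L ((1 - t) • x + t • y - x₀) = (1 - t) • L (x - x₀) + t • L (y - x₀) := by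
    rw [← map_smul, ← map_smul, ← map_add]; congr 1; module
  have h2 : ‖(1 - t) • L (x - x₀) + t • L (y - x₀)‖ ≤
      (1 - t) * ‖L (x - x₀)‖ + t * ‖L (y - x₀)‖ := by
    refine (norm_add_le _ _).trans ?_
    rw [norm_smul, norm_smul, Real.norm_of_nonneg hs, Real.norm_of_nonneg ht]
  rw [h1]
  have h3 := pow_le_pow_left₀ (norm_nonneg _) h2 2
  nlinarith [mul_nonneg (mul_nonneg hs ht) (sq_nonneg (‖L (x - x₀)‖ - ‖L (y - x₀)‖))]

/-- A conic restricted to a line through the origin is a quadratic polynomial. -/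
lemma conic_smul (L : V →ₗ[ℝ] EuclideanSpace ℝ (Fin 2)) (x₀ x : V) (t : ℝ) :
    conic L x₀ (t • x) = ‖L x‖ ^ 2 * t ^ 2 - 2 * inner ℝ (L x₀) (L x) * t + conic L x₀ 0 := by
  have := conic_add L x₀ 0 (t • x)
  rw [zero_add] at this
  rw [this, map_smul, norm_smul, mul_pow, inner_smul_right]
  simp only [zero_sub, map_neg, inner_neg_left, Real.norm_eq_abs, sq_abs]
  ring

lemma LineEnds.one_le {K : Set V} {u : V} {a b : ℝ} (h : LineEnds K u a b) (hu : u ∈ K) :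
    1 ≤ b := by
  by_contra hb
  exact h.b_max 1 (not_le.1 hb) (by simpa using hu)

variable {K : Set V} {A ε : ℝ} {F : Submodule ℝ V} {L : V →ₗ[ℝ] EuclideanSpace ℝ (Fin 2)}
  {x₀ v : V} {a b : ℝ}

lemma DeepFit.neg_le_conic_b (h : DeepFit K A ε F L x₀) (hK1 : K ⊆ closedBall 0 1)
    (hA : 100 ≤ A) (hε : 0 < ε) (hε1 : A ^ 3 * ε ≤ 1) (hv : v ∈ F)
    (hvK : closedBall v (3 / A) ⊆ K) (hab : LineEnds K v a b) :
    -(A ^ 3 * ε) ≤ conic L x₀ (b • v) := by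
  have hA0 : 0 < A := by linarith
  have hb1 := hab.one_le (hvK (mem_closedBall_self (by positivity)))
  have hpos : 0 < conic L x₀ (b • v + (b * (A * ε)) • v) := by
    by_contra hcon
    have h1 := h.shrink v hv hvK (b • v + (b * (A * ε)) • v)
      (F.add_mem (F.smul_mem _ hv) (F.smul_mem _ hv)) (not_lt.1 hcon)
    have h2 : v + (1 + A * ε)⁻¹ • (b • v + (b * (A * ε)) • v - v) =
        (1 + (1 + A * ε)⁻¹ * (b + b * (A * ε) - 1)) • v := by module
    rw [h2] at h1
    refine hab.b_max _ ?_ h1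
    have h3 : (1 + A * ε)⁻¹ * (b + b * (A * ε) - 1) = b - (1 + A * ε)⁻¹ := by
      field_simp
    have h4 : (1 + A * ε)⁻¹ < 1 := inv_lt_one_of_one_lt₀ (by nlinarith)
    linarith
  have h1 := conic_add_le (h.conic_nonpos _ hab.b_mem (F.smul_mem _ hv)) ((b * (A * ε)) • v)
  have h2 := h.upper _ (F.smul_mem (b * (A * ε)) hv)
  have h3 : ‖b • v‖ ≤ 1 := by simpa using hK1 hab.b_mem
  have h4 : ‖(b * (A * ε)) • v‖ ≤ A * ε := by
    rw [mul_comm, mul_smul, norm_smul, Real.norm_of_nonneg (by positivity)]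
    exact mul_le_of_le_one_right (by positivity) h3
  have h5 : ‖L ((b * (A * ε)) • v)‖ ≤ A ^ 2 * ε := by nlinarith
  have hA2 : A ^ 2 * ε ≤ 1 := by nlinarith [mul_pos (pow_pos hA0 2) hε]
  have h6 : 3 * (A ^ 2 * ε) ≤ A ^ 3 * ε := by nlinarith [mul_pos (pow_pos hA0 2) hε]
  nlinarith [norm_nonneg (L ((b * (A * ε)) • v))]

lemma DeepFit.neg_le_conic_a (h : DeepFit K A ε F L x₀) (hK1 : K ⊆ closedBall 0 1)
    (hA : 100 ≤ A) (hε : 0 < ε) (hε1 : A ^ 3 * ε ≤ 1) (hv : v ∈ F)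
    (hvK : closedBall v (3 / A) ⊆ K) (hab : LineEnds K v a b) :
    -(A ^ 3 * ε) ≤ conic L x₀ (-(a • v)) := by
  have hA0 : 0 < A := by linarith
  have ha0 := hab.a_nonneg
  have hpos : 0 < conic L x₀ (-(a • v) + (-((2 + a) * (A * ε))) • v) := by
    by_contra hcon
    have h1 := h.shrink v hv hvK (-(a • v) + (-((2 + a) * (A * ε))) • v)
      (F.add_mem (F.neg_mem (F.smul_mem _ hv)) (F.smul_mem _ hv)) (not_lt.1 hcon)
    have h2 : v + (1 + A * ε)⁻¹ • (-(a • v) + (-((2 + a) * (A * ε))) • v - v) =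
        -(((1 + A * ε)⁻¹ * (a + (2 + a) * (A * ε) + 1) - 1) • v) := by module
    rw [h2] at h1
    refine hab.a_max _ ?_ h1
    have h3 : (1 + A * ε)⁻¹ * (a + (2 + a) * (A * ε) + 1) = a + 2 - (1 + A * ε)⁻¹ := by
      field_simp; ring
    have h4 : (1 + A * ε)⁻¹ < 1 := inv_lt_one_of_one_lt₀ (by nlinarith)
    linarith
  have h1 := conic_add_le (h.conic_nonpos _ hab.a_mem (F.neg_mem (F.smul_mem _ hv)))
    ((-((2 + a) * (A * ε))) • v)
  have h2 := h.upper _ (F.smul_mem (-((2 + a) * (A * ε))) hv)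
  have h3 : ‖a • v‖ ≤ 1 := by simpa using hK1 hab.a_mem
  have h3' : ‖v‖ ≤ 1 := by simpa using hK1 (hvK (mem_closedBall_self (by positivity)))
  have h4 : ‖(-((2 + a) * (A * ε))) • v‖ ≤ 3 * (A * ε) := by
    rw [norm_smul, Real.norm_eq_abs, abs_neg, abs_of_nonneg (by positivity)]
    rw [norm_smul, Real.norm_of_nonneg ha0] at h3
    have : 0 < A * ε := by positivity
    nlinarith
  have h5 : ‖L ((-((2 + a) * (A * ε))) • v)‖ ≤ 3 * (A ^ 2 * ε) := by nlinarith
  have hA2 : 100 * (A ^ 2 * ε) ≤ A ^ 3 * ε := by nlinarith [mul_pos (pow_pos hA0 2) hε]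
  nlinarith [norm_nonneg (L ((-((2 + a) * (A * ε))) • v))]

end Fit

section Interior

lemma abs_quadratic_at_one_sub_le {q m c a b e₁ e₂ e : ℝ} (ha : 0 < a) (hb : 1 ≤ b)
    (h₁ : q * b ^ 2 - m * b - c = e₁) (h₂ : q * a ^ 2 + m * a - c = e₂)
    (he₁ : |e₁| ≤ e) (he₂ : |e₂| ≤ e) :
    |q - m - c - -(c * ((b - 1) * (1 + a) / (a * b)))| ≤ e * (1 + 1 / a) := by
  have hb0 : 0 < b := by linarith
  have key : q - m - c - -(c * ((b - 1) * (1 + a) / (a * b))) =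
      e₁ * ((1 + a) / (b * (b + a))) + e₂ * (-((b - 1) / (b + a) * (1 / a))) := by
    subst h₁ h₂
    field_simp
    ring
  have k1 : |(1 + a) / (b * (b + a))| ≤ 1 := by
    rw [abs_of_nonneg (by positivity), div_le_one (by positivity)]
    nlinarith
  have k2 : |-((b - 1) / (b + a) * (1 / a))| ≤ 1 / a := by
    rw [abs_neg, abs_of_nonneg
      (mul_nonneg (div_nonneg (by linarith) (by positivity)) (by positivity))]
    apply mul_le_of_le_one_left (by positivity)
    rw [div_le_one (by positivity)]
    linarith
  have he : 0 ≤ e := (abs_nonneg _).trans he₁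
  rw [key]
  calc _ ≤ |e₁| * |(1 + a) / (b * (b + a))| + |e₂| * |-((b - 1) / (b + a) * (1 / a))| := by
        rw [← abs_mul, ← abs_mul]; exact abs_add_le _ _
    _ ≤ e * 1 + e * (1 / a) := by gcongr
    _ = _ := by ring

lemma closedBall_subset_of_near {V : Type*} [NormedAddCommGroup V] {K : Set V} {A : ℝ} {p v : V}
    (hp : closedBall p (4 / A) ⊆ K)
    (hv : v ∈ closedBall p (1 / A)) : closedBall v (3 / A) ⊆ K := by
  refine (closedBall_subset_closedBall' ?_).trans hp
  rw [mem_closedBall] at hv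
  calc _ ≤ 3 / A + 1 / A := by gcongr
    _ = _ := by ring

lemma norm_near {V : Type*} [NormedAddCommGroup V] {A : ℝ} {p v : V} (hp0 : 8 / A ≤ ‖p‖)
    (hv : v ∈ closedBall p (1 / A)) : 7 / A ≤ ‖v‖ := by
  rw [mem_closedBall, dist_eq_norm, ← norm_sub_rev] at hv
  have h1 := norm_sub_norm_le p v
  have : (8 : ℝ) / A - 1 / A = 7 / A := by ring
  linarith

variable {V : Type*} [NormedAddCommGroup V] [NormedSpace ℝ V] {K : Set V} {A s : ℝ} {p : V}

lemma LineEnds.le_of_near (hK1 : K ⊆ closedBall 0 1) (hA : 100 ≤ A) {v : V} {a b : ℝ}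
    (hv : 7 / A ≤ ‖v‖) (h : LineEnds K v a b) : a ≤ A / 7 := by
  have h3 : ‖a • v‖ ≤ 1 := by simpa using hK1 h.a_mem
  rw [norm_smul, Real.norm_of_nonneg h.a_nonneg] at h3
  have h4 : a * (7 / A) ≤ 1 := le_trans (by have := h.a_nonneg; gcongr) h3
  have hA0 : 0 < A := by linarith
  rw [mul_div_assoc', div_le_one hA0] at h4
  linarith

lemma LineEnds.div_le_of_near (hK : Convex ℝ K) (hK1 : K ⊆ closedBall 0 1) (hA : 100 ≤ A)
    (hp : closedBall p (4 / A) ⊆ K) (hp0 : 8 / A ≤ ‖p‖) {v : V}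
    (hv : v ∈ closedBall p (1 / A)) {a b a' b' : ℝ} (h : LineEnds K p a b)
    (h' : LineEnds K v a' b') : a / A ≤ a' := by
  have hA0 : 0 < A := by linarith
  have ha := h.a_nonneg
  have haA : a ≤ A / 7 := h.le_of_near hK1 hA (le_trans (by gcongr; norm_num) hp0)
  have h1 : 2 * a / (3 + a) ≤ a' := by
    by_contra hcon
    refine h'.a_max _ (not_le.1 hcon) ?_
    have hw : p + (2 : ℝ) • (p - v) ∈ K := by
      apply hp
      rw [mem_closedBall, dist_eq_norm, add_sub_cancel_left, norm_smul]
      rw [mem_closedBall, dist_eq_norm, ← norm_sub_rev] at hv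
      rw [Real.norm_of_nonneg (by norm_num)]
      calc _ ≤ 2 * (1 / A) := by gcongr
        _ ≤ _ := by rw [mul_one_div]; gcongr; norm_num
    have := hK h.a_mem hw (a := 3 / (3 + a)) (b := a / (3 + a)) (by positivity) (by positivity)
      (by field_simp)
    convert this using 1
    match_scalars <;> field_simp
    ring
  refine le_trans ?_ h1
  rw [div_le_div_iff₀ hA0 (by positivity)]
  nlinarith

/-- If the origin has depth at least `√ε` in `K`, the normalised conics agree near `p`. -/
lemma exists_common_of_deep (hK : Convex ℝ K) (hKc : IsCompact K) (hK1 : K ⊆ closedBall 0 1)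
    (h0 : (0 : V) ∈ K) (hA : 100 ≤ A) (hp : closedBall p (4 / A) ⊆ K) (hp0 : 8 / A ≤ ‖p‖)
    (hs : 0 < s) (hsA : s * A ^ 40 ≤ 1) {a b : ℝ} (hab : LineEnds K p a b) (has : s ≤ a) :
    ∃ Φ : V → ℝ, ∀ F : Submodule ℝ V, ∀ L x₀, DeepFit K A (s ^ 2) F L x₀ →
      ∀ u ∈ F, u ∈ closedBall p (1 / A) →
      ∃ σ : ℝ, 0 < σ ∧ σ ≤ A ^ 5 ∧ (p ∈ F → 1 ≤ A ^ 5 * σ) ∧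
        ∀ v ∈ F, v ∈ closedBall p (1 / A) → |σ * conic L x₀ v - Φ v| ≤ A ^ 10 * s := by
  have hA0 : 0 < A := by linarith
  have ha0 : 0 < a := by linarith
  have hex : ∀ v : V, ∃ ab : ℝ × ℝ, v ≠ 0 → LineEnds K v ab.1 ab.2 := by
    intro v
    by_cases hv : v = 0
    · exact ⟨0, fun h => absurd hv h⟩
    · obtain ⟨a, b, h⟩ := exists_lineEnds hKc h0 hv
      exact ⟨(a, b), fun _ => h⟩
  choose g hg using hex
  refine ⟨fun v => -(a * (((g v).2 - 1) * (1 + (g v).1) / ((g v).1 * (g v).2))), ?_⟩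
  intro F L x₀ hF u hu hup
  set c := -conic L x₀ 0 with hc
  have hs1 : s ≤ 1 := by
    have : 1 ≤ A ^ 40 := one_le_pow₀ (by linarith)
    nlinarith
  have hsε : A ^ 3 * s ^ 2 ≤ 1 := by
    have h1 : A ^ 3 ≤ A ^ 40 := pow_le_pow_right₀ (by linarith) (by norm_num)
    have : A ^ 3 * s ≤ 1 := le_trans (by rw [mul_comm]; gcongr) hsA
    nlinarith [pow_pos hA0 3]
  have hs2 : 0 < s ^ 2 := by positivity
  have hends : ∀ v ∈ closedBall p (1 / A), LineEnds K v (g v).1 (g v).2 ∧ a / A ≤ (g v).1 ∧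
      (g v).1 ≤ A / 7 := by
    intro v hv
    have h1 := norm_near hp0 hv
    have h2 := hg v (by rintro rfl; rw [norm_zero] at h1; exact absurd h1 (by push Not; positivity))
    exact ⟨h2, hab.div_le_of_near hK hK1 hA hp hp0 hv h2, h2.le_of_near hK1 hA h1⟩
  -- the conic at the origin is comparable with the depth
  have hca : 2 * a ≤ A ^ 3 * c := by
    obtain ⟨h1, h2, h3⟩ := hends u hup
    set a' := (g u).1
    have ha' : 0 < a' := lt_of_lt_of_le (by positivity) h2
    have h4 := hF.deep u hu (closedBall_subset_of_near hp hup)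
    have h5 := hF.conic_nonpos _ h1.a_mem (F.neg_mem (F.smul_mem _ hu))
    have h6 := conic_convex L x₀ u (-(a' • u)) (s := a' / (1 + a')) (t := 1 / (1 + a'))
      (by positivity) (by positivity) (by field_simp; ring)
    have h7 : (a' / (1 + a')) • u + (1 / (1 + a')) • -(a' • u) = 0 := by
      match_scalars; field_simp; ring
    rw [h7] at h6
    have h8 : 1 / (1 + a') * conic L x₀ (-(a' • u)) ≤ 0 :=
      mul_nonpos_of_nonneg_of_nonpos (by positivity) h5
    have h9 : a' / (1 + a') * conic L x₀ u ≤ a' / (1 + a') * (-(2 / A)) := by gcongr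
    have h10 : a' / (1 + a') * (2 / A) ≤ c := by rw [hc]; linarith
    have h11 : 2 * a / A ^ 3 ≤ a' / (1 + a') * (2 / A) := by
      rw [div_mul_div_comm, div_le_div_iff₀ (by positivity) (by positivity)]
      rw [div_le_iff₀ hA0] at h2
      have : 1 + a' ≤ A := by linarith
      calc 2 * a * ((1 + a') * A) ≤ 2 * (a' * A) * (A * A) := by gcongr
        _ = _ := by ring
    rw [div_le_iff₀ (by positivity)] at h11
    have : a' / (1 + a') * (2 / A) * A ^ 3 ≤ c * A ^ 3 := by gcongr
    linarith
  have hc0 : 0 < c := by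
    by_contra hcon
    nlinarith [pow_pos hA0 3]
  refine ⟨a / c, by positivity, ?_, ?_, ?_⟩
  · rw [div_le_iff₀ hc0]
    have : A ^ 3 ≤ A ^ 5 := pow_le_pow_right₀ (by linarith) (by norm_num)
    nlinarith
  · intro hpF
    have h1 := hF.neg_le_conic_a hK1 hA hs2 hsε hpF
      ((closedBall_subset_closedBall (by gcongr; norm_num)).trans hp) hab
    have h2 := conic_add_le (hF.conic_nonpos 0 h0 F.zero_mem) (-(a • p))
    rw [zero_add] at h2
    have hpn : ‖p‖ ≤ 1 := by simpa using hK1 (hp (mem_closedBall_self (by positivity)))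
    have h3 : ‖L (-(a • p))‖ ≤ A * a := by
      refine (hF.upper _ (F.neg_mem (F.smul_mem _ hpF))).trans ?_
      rw [norm_neg, norm_smul, Real.norm_of_nonneg ha0.le]
      gcongr
      exact mul_le_of_le_one_right ha0.le hpn
    have haA : a ≤ A := by
      have := hab.le_of_near hK1 hA (le_trans (by gcongr; norm_num) hp0)
      linarith
    have h4 : c ≤ A ^ 3 * s ^ 2 + 2 * (A * a) + (A * a) ^ 2 := by
      have := pow_le_pow_left₀ (norm_nonneg _) h3 2
      rw [hc]; linarith
    have h5 : A ^ 3 * s ^ 2 ≤ A ^ 3 * a * 1 := by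
      rw [mul_assoc, pow_two]; gcongr
    have h6 : (A * a) ^ 2 ≤ A ^ 3 * a := by
      have : (A * a) ^ 2 = A ^ 2 * a * a := by ring
      rw [this]
      calc A ^ 2 * a * a ≤ A ^ 2 * a * A := by gcongr
        _ = _ := by ring
    have h7 : A * a ≤ A ^ 3 * a := by
      gcongr; exact le_self_pow₀ (by linarith) (by norm_num)
    have h8 : 4 * (A ^ 3 * a) ≤ A ^ 5 * a := by
      have : (4 : ℝ) ≤ A ^ 2 := by nlinarith
      calc 4 * (A ^ 3 * a) ≤ A ^ 2 * (A ^ 3 * a) := by gcongr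
        _ = _ := by ring
    rw [mul_div_assoc', le_div_iff₀ hc0]
    linarith
  · intro v hv hvp
    obtain ⟨h1, h2, h3⟩ := hends v hvp
    have hvK := closedBall_subset_of_near hp hvp
    dsimp only
    set a' := (g v).1
    set b' := (g v).2
    have ha' : 0 < a' := lt_of_lt_of_le (by positivity) h2
    have k1 := hF.neg_le_conic_b hK1 hA hs2 hsε hv hvK h1
    have k2 := hF.neg_le_conic_a hK1 hA hs2 hsε hv hvK h1
    have k3 := hF.conic_nonpos _ h1.b_mem (F.smul_mem _ hv)
    have k4 := hF.conic_nonpos _ h1.a_mem (F.neg_mem (F.smul_mem _ hv))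
    have hb1 := h1.one_le (hvK (mem_closedBall_self (by positivity)))
    have e1 := conic_smul L x₀ v b'
    have e2 := conic_smul L x₀ v (-a')
    have e3 := conic_smul L x₀ v 1
    rw [one_smul] at e3
    rw [neg_smul] at e2
    have key := abs_quadratic_at_one_sub_le (q := ‖L v‖ ^ 2) (m := 2 * inner ℝ (L x₀) (L v))
      (c := c) (e := A ^ 3 * s ^ 2) (e₁ := conic L x₀ (b' • v)) (e₂ := conic L x₀ (-(a' • v)))
      ha' hb1 (by rw [e1, hc]; ring) (by rw [e2, hc]; ring)
      (abs_le.2 ⟨k1, k3.trans (by positivity)⟩) (abs_le.2 ⟨k2, k4.trans (by positivity)⟩)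
    have e4 : a / c * conic L x₀ v - -(a * ((b' - 1) * (1 + a') / (a' * b'))) = a / c *
        (‖L v‖ ^ 2 - 2 * inner ℝ (L x₀) (L v) - c - -(c * ((b' - 1) * (1 + a') / (a' * b')))) := by
      rw [e3, show conic L x₀ 0 = -c by rw [hc]; ring]
      field_simp
      ring
    rw [e4, abs_mul, abs_of_pos (by positivity : 0 < a / c)]
    have e5 : a / c ≤ A ^ 3 := by rw [div_le_iff₀ hc0]; linarith
    have e6 : 1 / a' ≤ A / s := by
      rw [div_le_div_iff₀ ha' hs]
      rw [div_le_iff₀ hA0] at h2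
      linarith
    have e7 : 1 ≤ A / s := by rw [le_div_iff₀ hs]; linarith
    calc _ ≤ A ^ 3 * (A ^ 3 * s ^ 2 * (A / s + A / s)) := by
          gcongr
          exact key.trans (by gcongr)
      _ = 2 * A ^ 7 * s := by field_simp; ring
      _ ≤ A ^ 3 * A ^ 7 * s := by
          gcongr
          nlinarith [sq_nonneg A]
      _ = _ := by ring

end Interior

section Shallow

variable {V : Type*} [NormedAddCommGroup V] [NormedSpace ℝ V] {K : Set V} {A s : ℝ} {p : V}

lemma LineEnds.exists_support (hK : Convex ℝ K) {r : ℝ} (hr : 0 < r)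
    (hp : closedBall p r ⊆ K) (hp0 : p ≠ 0) {a b : ℝ} (h : LineEnds K p a b) :
    ∃ M : V →ₗ[ℝ] ℝ, M p = 1 ∧ ∀ x ∈ K, -a ≤ M x := by
  have hpint : p ∈ interior K := interior_mono hp (ball_subset_interior_closedBall
    (mem_ball_self hr))
  have hnot : -(a • p) ∉ interior K := by
    intro hmem
    obtain ⟨δ, hδ, hball⟩ := Metric.isOpen_iff.1 isOpen_interior _ hmem
    have hpn : 0 < ‖p‖ := norm_pos_iff.2 hp0
    refine h.a_max (a + δ / (2 * ‖p‖)) (by simp; positivity) (interior_subset (hball ?_))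
    rw [mem_ball, dist_eq_norm,
      show -((a + δ / (2 * ‖p‖)) • p) - -(a • p) = -((δ / (2 * ‖p‖)) • p) by module,
      norm_neg, norm_smul, Real.norm_of_nonneg (by positivity)]
    have : δ / (2 * ‖p‖) * ‖p‖ = δ / 2 := by field_simp
    linarith
  obtain ⟨f, hf⟩ := geometric_hahn_banach_open_point hK.interior isOpen_interior hnot
  have hfK : ∀ x ∈ K, f x ≤ f (-(a • p)) := by
    intro x hx
    have hcl : x ∈ closure (interior K) := by
      rw [hK.closure_interior_eq_closure_of_nonempty_interior ⟨p, hpint⟩]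
      exact subset_closure hx
    exact closure_minimal (fun y hy => (hf y hy).le)
      (isClosed_le f.continuous continuous_const) hcl
  have hfp := hf p hpint
  rw [map_neg, map_smul, smul_eq_mul] at hfp hfK
  have hfp0 : f p < 0 := by
    by_contra hcon
    have := mul_nonneg h.a_nonneg (not_lt.1 hcon)
    linarith
  refine ⟨(f p)⁻¹ • f.toLinearMap, ?_, ?_⟩
  · simp [hfp0.ne]
  · intro x hx
    have h1 := hfK x hx
    simp only [LinearMap.smul_apply, smul_eq_mul]
    change -a ≤ (f p)⁻¹ * f x
    have h2 : (f p)⁻¹ * -(a * f p) ≤ (f p)⁻¹ * f x :=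
      mul_le_mul_of_nonpos_left h1 (inv_nonpos.2 hfp0.le)
    have h3 : (f p)⁻¹ * -(a * f p) = -a := by field_simp [hfp0.ne]
    linarith

lemma abs_support_le (hA : 100 ≤ A) (hp : closedBall p (4 / A) ⊆ K) {a : ℝ} (ha : a ≤ 1)
    {M : V →ₗ[ℝ] ℝ} (hMp : M p = 1) (hM : ∀ x ∈ K, -a ≤ M x) (y : V) :
    |M y| ≤ A / 2 * ‖y‖ := by
  have hA0 : 0 < A := by linarith
  have key : ∀ y : V, -(A / 2 * ‖y‖) ≤ M y := by
    intro y
    rcases eq_or_ne y 0 with rfl | hy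
    · simp
    have hyn : 0 < ‖y‖ := norm_pos_iff.2 hy
    have h1 := hM (p + (4 / A / ‖y‖) • y) (hp (by
      rw [mem_closedBall, dist_eq_norm, add_sub_cancel_left, norm_smul,
        Real.norm_of_nonneg (by positivity), div_mul_cancel₀ _ hyn.ne']))
    rw [map_add, map_smul, hMp, smul_eq_mul] at h1
    have h2 : -2 ≤ 4 / A / ‖y‖ * M y := by linarith
    have h3 : 4 / A / ‖y‖ * M y * (A * ‖y‖ / 4) = M y := by field_simp
    have h4 : -2 * (A * ‖y‖ / 4) ≤ 4 / A / ‖y‖ * M y * (A * ‖y‖ / 4) := by gcongr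
    linarith
  rw [abs_le]
  refine ⟨key y, ?_⟩
  have := key (-y)
  rw [map_neg, norm_neg] at this
  linarith

lemma DeepFit.kernel_part_close {F : Submodule ℝ V} {L : V →ₗ[ℝ] EuclideanSpace ℝ (Fin 2)}
    {x₀ : V} (hA : 100 ≤ A) (hs : 0 < s) (hs1 : s ≤ 1)
    (hsA : 10000 * (A * s ^ 2) ≤ s) (hF : DeepFit K A (s ^ 2) F L x₀) {m : V →ₗ[ℝ] ℝ} {c : ℝ}
    (hquad : ∀ x, conic L x₀ x = ‖L x‖ ^ 2 - m x - c)
    {a : ℝ} (ha : 0 ≤ a) (has : a ≤ s) {M : V →ₗ[ℝ] ℝ} (hM : ∀ x ∈ K, -a ≤ M x)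
    {v : V} (hv : v ∈ F) (hvK : closedBall v (3 / A) ⊆ K) (hqv : ‖L v‖ ^ 2 ≤ A ^ 2)
    (hMv1 : 1 / 2 ≤ M v) (hMv2 : M v ≤ 3 / 2)
    {ω B σ : ℝ} (hσ0 : 0 < σ) (hσA : σ ≤ A ^ 2) (hσm : σ * m v = M v) (hcω : a - ω ≤ σ * c)
    (hB : 0 ≤ B) (hωB : A ^ 5 * s ^ 2 + ω ≤ B ^ 2 * s ^ 2) {w : V} (hw : w ∈ F) (hMw : M w = 0) :
    |σ * m w| ≤ 3 * A ^ 2 * B * s * ‖w‖ := by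
  have hA0 : 0 < A := by linarith
  have hA1 : 1 ≤ A := by linarith
  have hs2 : 0 < s ^ 2 := by positivity
  have hMvpos : 0 < M v := by linarith
  obtain ⟨τ, hτM⟩ : ∃ τ, τ * M v = a + 4 * A * s ^ 2 := ⟨_, div_mul_cancel₀ _ hMvpos.ne'⟩
  have hr : 0 ≤ a + 4 * A * s ^ 2 := by positivity
  have hτ0 : 0 ≤ τ := by
    by_contra hcon
    have := mul_neg_of_neg_of_pos (not_le.1 hcon) hMvpos
    linarith
  have hτs : τ ≤ 4 * s := by
    have : τ * (1 / 2) ≤ τ * M v := by gcongr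
    linarith
  have hAs : 0 < A * s ^ 2 := by positivity
  have hineq : ∀ y : ℝ,
      0 ≤ (2 * (σ * ‖L w‖ ^ 2)) * (y * y) + (-(σ * m w)) * y + B ^ 2 * s ^ 2 := by
    intro y
    have hxF : y • w - τ • v ∈ F := F.sub_mem (F.smul_mem _ hw) (F.smul_mem _ hv)
    have h1 : 0 < conic L x₀ (y • w - τ • v) := by
      by_contra hcon
      have h2 := hM _ (hF.shrink v hv hvK _ hxF (not_lt.1 hcon))
      simp only [map_add, map_smul, map_sub, smul_eq_mul, hMw] at h2
      have hAε : 0 < 1 + A * s ^ 2 := by positivity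
      have h3 : (1 + A * s ^ 2)⁻¹ * (y * 0 - τ * M v - M v) =
          -((1 + A * s ^ 2)⁻¹ * (a + 4 * A * s ^ 2 + M v)) := by rw [← hτM]; ring
      rw [h3] at h2
      have h4 : a + 4 * A * s ^ 2 + M v ≤ (1 + A * s ^ 2) * (a + M v) := by
        rw [← inv_mul_le_iff₀ hAε]; linarith
      have h5 : A * s ^ 2 * (a + M v) ≤ A * s ^ 2 * (5 / 2) := by gcongr; linarith
      linarith
    have h2 := hquad (y • w - τ • v)
    have h3 : m (y • w - τ • v) = y * m w - τ * m v := by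
      simp only [map_sub, map_smul, smul_eq_mul]
    have h4 : ‖L (y • w - τ • v)‖ ^ 2 ≤ 2 * (y ^ 2 * ‖L w‖ ^ 2) + 2 * (τ ^ 2 * ‖L v‖ ^ 2) := by
      have e1 : ‖y • L w‖ ^ 2 = y ^ 2 * ‖L w‖ ^ 2 := by
        rw [norm_smul, mul_pow, Real.norm_eq_abs, sq_abs]
      have e2 : ‖τ • L v‖ ^ 2 = τ ^ 2 * ‖L v‖ ^ 2 := by
        rw [norm_smul, mul_pow, Real.norm_eq_abs, sq_abs]
      rw [map_sub, map_smul, map_smul, ← e1, ← e2]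
      have := parallelogram_law_with_norm ℝ (y • L w) (τ • L v)
      have := sq_nonneg ‖y • L w + τ • L v‖
      linarith
    have h5 : τ ^ 2 * ‖L v‖ ^ 2 ≤ (4 * s) ^ 2 * A ^ 2 := by gcongr
    have h6 : 0 ≤ σ * (2 * (y ^ 2 * ‖L w‖ ^ 2) + 2 * ((4 * s) ^ 2 * A ^ 2) -
        (y * m w - τ * m v) - c) := by
      apply mul_nonneg hσ0.le
      rw [h3] at h2
      linarith
    have h7 : σ * (2 * ((4 * s) ^ 2 * A ^ 2)) ≤ A ^ 2 * (2 * ((4 * s) ^ 2 * A ^ 2)) := by gcongr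
    have h8 : σ * (τ * m v) = a + 4 * A * s ^ 2 := by rw [← hτM, ← hσm]; ring
    have h9 : A ^ 2 * (2 * ((4 * s) ^ 2 * A ^ 2)) + 4 * A * s ^ 2 ≤ A ^ 5 * s ^ 2 := by
      have e1 : 32 * A ^ 4 + 4 * A ≤ A ^ 5 := by
        have : A ≤ A ^ 4 := le_self_pow₀ hA1 (by norm_num)
        have : 100 * A ^ 4 ≤ A * A ^ 4 := by gcongr
        linarith
      calc _ = (32 * A ^ 4 + 4 * A) * s ^ 2 := by ring
        _ ≤ _ := by gcongr
    linarith
  have hd := discrim_le_zero hineq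
  rw [discrim] at hd
  have hLw : σ * ‖L w‖ ^ 2 ≤ A ^ 2 * (A * ‖w‖) ^ 2 := by
    gcongr; exact hF.upper w hw
  apply abs_le_of_sq_le_sq _ (by positivity)
  have h1 : 4 * (2 * (σ * ‖L w‖ ^ 2)) * (B ^ 2 * s ^ 2) ≤
      4 * (2 * (A ^ 2 * (A * ‖w‖) ^ 2)) * (B ^ 2 * s ^ 2) := by gcongr
  have h2 : 0 ≤ A ^ 4 * ‖w‖ ^ 2 * B ^ 2 * s ^ 2 := by positivity
  linarith

/-- The linear part of a conic close to a section is, after normalisation, close to a functional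
supporting `K` near the origin. -/
lemma DeepFit.linear_part_close (hK1 : K ⊆ closedBall 0 1)
    (h0 : (0 : V) ∈ K) (hA : 100 ≤ A) (hp : closedBall p (4 / A) ⊆ K)
    (hs : 0 < s) (hsA : s * A ^ 40 ≤ 1) {a : ℝ} (ha : 0 ≤ a) (has : a ≤ s)
    {M : V →ₗ[ℝ] ℝ} (hMp : M p = 1) (hM : ∀ x ∈ K, -a ≤ M x)
    {F : Submodule ℝ V} {L : V →ₗ[ℝ] EuclideanSpace ℝ (Fin 2)} {x₀ : V}
    (hF : DeepFit K A (s ^ 2) F L x₀) {v : V} (hv : v ∈ F) (hvp : v ∈ closedBall p (1 / A))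
    {a' b' : ℝ} (hv' : LineEnds K v a' b') {ω B : ℝ} (hω : a - ω ≤ a' * M v) (hB : 0 ≤ B)
    (hωB : A ^ 5 * s ^ 2 + ω ≤ B ^ 2 * s ^ 2) :
    ∃ σ : ℝ, 0 < σ ∧ σ ≤ A ^ 2 ∧ 1 ≤ A ^ 2 * σ ∧ 0 ≤ -(σ * conic L x₀ 0) ∧
      -(σ * conic L x₀ 0) ≤ A ^ 4 * s ∧ a - ω ≤ -(σ * conic L x₀ 0) ∧
      ∀ x ∈ F, |σ * (2 * inner ℝ (L x₀) (L x)) - M x| ≤ A ^ 4 * B * s * ‖x‖ := by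
  have hA0 : 0 < A := by linarith
  have hA1 : 1 ≤ A := by linarith
  have hs2 : 0 < s ^ 2 := by positivity
  have hA4s : A ^ 4 * s ≤ 1 := by
    have h1 : A ^ 4 ≤ A ^ 40 := pow_le_pow_right₀ hA1 (by norm_num)
    exact le_trans (by rw [mul_comm]; gcongr) hsA
  have hA3s : A ^ 3 * s ≤ 1 := le_trans (by gcongr; norm_num) hA4s
  have hA2s' : A ^ 2 * s ≤ 1 := le_trans (by gcongr; norm_num) hA4s
  have hs1 : s ≤ 1 := by
    have : 1 ≤ A ^ 3 := one_le_pow₀ hA1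
    nlinarith
  have hsε : A ^ 3 * s ^ 2 ≤ s := by
    calc _ = A ^ 3 * s * s := by ring
      _ ≤ 1 * s := by gcongr
      _ = s := one_mul s
  have hA2s : 100 * (A ^ 2 * s ^ 2) ≤ s := by
    refine le_trans ?_ hsε
    calc _ ≤ A * (A ^ 2 * s ^ 2) := by gcongr
      _ = _ := by ring
  have hA1s : 10000 * (A * s ^ 2) ≤ s := by
    refine le_trans ?_ hA2s
    calc 10000 * (A * s ^ 2) = 100 * (100 * A * s ^ 2) := by ring
      _ ≤ 100 * (A * A * s ^ 2) := by gcongr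
      _ = _ := by ring
  have hvK := closedBall_subset_of_near hp hvp
  have hvmem : v ∈ K := hvK (mem_closedBall_self (by positivity))
  have hvn : ‖v‖ ≤ 1 := by simpa using hK1 hvmem
  have hMv : |M v - 1| ≤ 1 / 2 := by
    have h1 := abs_support_le hA hp (has.trans hs1) hMp hM (v - p)
    rw [map_sub, hMp] at h1
    refine h1.trans ?_
    rw [mem_closedBall, dist_eq_norm] at hvp
    calc A / 2 * ‖v - p‖ ≤ A / 2 * (1 / A) := by gcongr
      _ = 1 / 2 := by field_simp
  obtain ⟨hMv1, hMv2⟩ := abs_le.1 hMv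
  have hMvpos : 0 < M v := by linarith
  have ha'0 := hv'.a_nonneg
  have ha'M : a' * M v ≤ a := by
    have := hM _ hv'.a_mem
    rw [map_neg, map_smul, smul_eq_mul] at this
    linarith
  have ha' : a' ≤ 2 * s := by
    have : a' * (1 / 2) ≤ a' * M v := by gcongr; linarith
    linarith
  obtain ⟨c, hc⟩ : ∃ c, conic L x₀ 0 = -c := ⟨_, (neg_neg _).symm⟩
  obtain ⟨m, hm⟩ : ∃ m : V →ₗ[ℝ] ℝ, ∀ x, m x = 2 * inner ℝ (L x₀) (L x) :=
    ⟨(2 : ℝ) • (innerₛₗ ℝ (L x₀)) ∘ₗ L, fun x => by simp⟩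
  have hconic0 := hF.conic_nonpos 0 h0 F.zero_mem
  have hc0 : 0 ≤ c := by linarith
  have hLx₀ : ‖L x₀‖ ≤ 1 := by
    have := conic_nonpos_iff.1 hconic0
    rwa [zero_sub, map_neg, norm_neg] at this
  have hmle : ∀ x ∈ F, |m x| ≤ 2 * A * ‖x‖ := by
    intro x hx
    rw [hm, abs_mul, abs_two, mul_assoc]
    gcongr
    refine (abs_real_inner_le_norm _ _).trans ?_
    calc _ ≤ 1 * (A * ‖x‖) := by gcongr; exact hF.upper x hx
      _ = _ := one_mul _
  have hquadt : ∀ x (t : ℝ), conic L x₀ (t • x) = ‖L x‖ ^ 2 * t ^ 2 - m x * t - c := by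
    intro x t
    rw [conic_smul, hc, hm]; ring
  have hquad : ∀ x, conic L x₀ x = ‖L x‖ ^ 2 - m x - c := by
    intro x
    have := hquadt x 1
    rw [one_smul] at this
    linarith
  have hqv : ‖L v‖ ^ 2 ≤ A ^ 2 := by
    have := (hF.upper v hv).trans (mul_le_of_le_one_right hA0.le hvn)
    gcongr
  have hmv2 : m v ≤ 2 * A := by
    refine ((le_abs_self _).trans (hmle v hv)).trans ?_
    exact mul_le_of_le_one_right (by positivity) hvn
  have hcs : c ≤ A ^ 2 * s := by
    have h1 := hF.neg_le_conic_a hK1 hA hs2 (hsε.trans hs1) hv hvK hv'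
    rw [← neg_smul, hquadt] at h1
    have h2 : ‖L v‖ ^ 2 * (-a') ^ 2 ≤ A ^ 2 * (2 * s) ^ 2 := by
      rw [neg_sq]; gcongr
    have h3 : m v * a' ≤ 2 * A * (2 * s) := by gcongr
    have h4 : 10 * s * (10 * 10) ≤ A * s * A := by
      have : 10000 ≤ A * A := by nlinarith
      nlinarith
    have h5 : 100 * (A * s) ≤ A * (A * s) := by gcongr
    linarith
  have hcA : c ≤ 1 / A := by
    rw [le_div_iff₀ hA0]
    calc c * A ≤ A ^ 2 * s * A := by gcongr
      _ = A ^ 3 * s := by ring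
      _ ≤ 1 := hA3s
  have hmv : 1 / A ≤ m v := by
    have h1 := hF.deep v hv hvK
    have h2 := hquad v
    have h3 : 2 / A = 1 / A + 1 / A := by ring
    have : 0 ≤ ‖L v‖ ^ 2 := by positivity
    linarith
  have hmv0 : 0 < m v := lt_of_lt_of_le (by positivity) hmv
  obtain ⟨σ, hσm⟩ : ∃ σ, σ * m v = M v := ⟨_, div_mul_cancel₀ _ hmv0.ne'⟩
  have hσ0 : 0 < σ := by
    by_contra hcon
    have := mul_nonpos_of_nonpos_of_nonneg (not_lt.1 hcon) hmv0.le
    linarith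
  have hσA : σ ≤ A ^ 2 := by
    have h1 : σ * (1 / A) ≤ 3 / 2 := le_trans (by gcongr) (hσm.le.trans (by linarith))
    rw [mul_one_div, div_le_iff₀ hA0] at h1
    have : 100 * A ≤ A * A := by gcongr
    linarith
  have hσA' : 1 ≤ A ^ 2 * σ := by
    have h1 : 1 / 2 ≤ σ * (2 * A) := le_trans (by linarith [hσm])
      (mul_le_mul_of_nonneg_left hmv2 hσ0.le)
    have : 100 * (A * σ) ≤ A * (A * σ) := by gcongr
    linarith
  have hcω : a - ω ≤ σ * c := by
    have h1 := hF.conic_nonpos _ hv'.a_mem (F.neg_mem (F.smul_mem _ hv))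
    rw [← neg_smul, hquadt] at h1
    have h2 : σ * (‖L v‖ ^ 2 * (-a') ^ 2 - m v * -a' - c) ≤ 0 :=
      mul_nonpos_of_nonneg_of_nonpos hσ0.le h1
    have h3 : 0 ≤ σ * (‖L v‖ ^ 2 * (-a') ^ 2) := by positivity
    have h4 : σ * (m v * a') = a' * M v := by rw [← hσm]; ring
    linarith
  rw [hc]
  refine ⟨σ, hσ0, hσA, hσA', ?_, ?_, ?_, ?_⟩
  · rw [mul_neg, neg_neg]; positivity
  · rw [mul_neg, neg_neg]
    calc σ * c ≤ A ^ 2 * (A ^ 2 * s) := by gcongr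
      _ = _ := by ring
  · rw [mul_neg, neg_neg]; exact hcω
  · intro x hx
    obtain ⟨w, hw⟩ : ∃ w, w = x - (M x / M v) • v := ⟨_, rfl⟩
    have hwF : w ∈ F := hw ▸ F.sub_mem hx (F.smul_mem _ hv)
    have hMw : M w = 0 := by
      rw [hw, map_sub, map_smul, smul_eq_mul, div_mul_cancel₀ _ hMvpos.ne', sub_self]
    have h1 := hF.kernel_part_close hA hs hs1 hA1s hquad ha has hM hv hvK hqv (by linarith)
      (by linarith) hσ0 hσA hσm hcω hB hωB hwF hMw
    have h2 : σ * (2 * inner ℝ (L x₀) (L x)) - M x = σ * m w := by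
      rw [hw, ← hm, map_sub, map_smul, smul_eq_mul, mul_sub, mul_left_comm, hσm,
        div_mul_cancel₀ _ hMvpos.ne']
    have h3 : ‖w‖ ≤ 2 * A * ‖x‖ := by
      rw [hw]
      refine (norm_sub_le _ _).trans ?_
      have h4 : ‖(M x / M v) • v‖ ≤ A * ‖x‖ := by
        rw [norm_smul, Real.norm_eq_abs, abs_div, abs_of_pos hMvpos]
        have h5 := abs_support_le hA hp (has.trans hs1) hMp hM x
        have h6 : |M x| / M v ≤ A * ‖x‖ := by
          rw [div_le_iff₀ hMvpos]
          calc |M x| ≤ A / 2 * ‖x‖ := h5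
            _ = A * ‖x‖ * (1 / 2) := by ring
            _ ≤ A * ‖x‖ * M v := by gcongr; linarith
        calc _ ≤ A * ‖x‖ * 1 := by gcongr
          _ = _ := mul_one _
      have : ‖x‖ ≤ A * ‖x‖ := le_mul_of_one_le_left (norm_nonneg x) hA1
      linarith
    rw [h2]
    calc |σ * m w| ≤ 3 * A ^ 2 * B * s * (2 * A * ‖x‖) := h1.trans (by gcongr)
      _ = 6 * A ^ 3 * B * s * ‖x‖ := by ring
      _ ≤ A * A ^ 3 * B * s * ‖x‖ := by gcongr; linarith
      _ = _ := by ring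

end Shallow

section Common

variable {V : Type*} [NormedAddCommGroup V] [NormedSpace ℝ V] {K : Set V} {A s : ℝ} {p : V}

lemma abs_quadratic_at_one_sub_le' {q m c b e M δ : ℝ} (hb : 1 ≤ b)
    (h₁ : q * b ^ 2 - m * b - c = e) (hm : |m - M| ≤ δ) :
    |q - m - c - M * (1 / b - 1)| ≤ |e| + δ + |c| := by
  have hb0 : 0 < b := by linarith
  have hb1 : 1 / b ≤ 1 := by rw [div_le_one hb0]; exact hb
  have hbp : 0 < 1 / b := by positivity
  have key : q - m - c - M * (1 / b - 1) =
      e * (1 / b) ^ 2 + (m - M) * (1 / b - 1) + c * ((1 / b) ^ 2 - 1) := by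
    subst h₁
    field_simp
    ring
  have k1 : |(1 / b) ^ 2| ≤ 1 := by
    rw [abs_of_pos (by positivity)]; exact pow_le_one₀ hbp.le hb1
  have k2 : |1 / b - 1| ≤ 1 := abs_le.2 ⟨by linarith, by linarith⟩
  have k3 : |(1 / b) ^ 2 - 1| ≤ 1 :=
    abs_le.2 ⟨by linarith [pow_pos hbp 2], by linarith [le_abs_self ((1 / b) ^ 2)]⟩
  rw [key]
  calc _ ≤ |e| * |(1 / b) ^ 2| + |m - M| * |1 / b - 1| + |c| * |(1 / b) ^ 2 - 1| := by
        simp only [← abs_mul]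
        exact abs_add_three _ _ _
    _ ≤ |e| * 1 + δ * 1 + |c| * 1 := by
        have := (abs_nonneg _).trans hm
        gcongr
    _ = _ := by ring

lemma half_le_support (hA : 100 ≤ A) (hp : closedBall p (4 / A) ⊆ K) {a : ℝ} (ha : a ≤ 1)
    {M : V →ₗ[ℝ] ℝ} (hMp : M p = 1) (hM : ∀ x ∈ K, -a ≤ M x) {v : V}
    (hv : v ∈ closedBall p (1 / A)) : 1 / 2 ≤ M v := by
  have hA0 : 0 < A := by linarith
  have h1 := abs_support_le hA hp ha hMp hM (v - p)
  rw [map_sub, hMp] at h1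
  rw [mem_closedBall, dist_eq_norm] at hv
  have h2 : A / 2 * ‖v - p‖ ≤ 1 / 2 := by
    calc A / 2 * ‖v - p‖ ≤ A / 2 * (1 / A) := by gcongr
      _ = 1 / 2 := by field_simp
  have := (abs_le.1 (h1.trans h2)).1
  linarith

lemma LineEnds.le_two_mul (hA : 100 ≤ A) (hp : closedBall p (4 / A) ⊆ K) {a : ℝ} (ha : a ≤ 1)
    {M : V →ₗ[ℝ] ℝ} (hMp : M p = 1) (hM : ∀ x ∈ K, -a ≤ M x) {v : V}
    (hv : v ∈ closedBall p (1 / A)) {a' b' : ℝ} (h : LineEnds K v a' b') : a' ≤ 2 * a := by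
  have h1 := hM _ h.a_mem
  rw [map_neg, map_smul, smul_eq_mul] at h1
  have h2 := half_le_support hA hp ha hMp hM hv
  have : a' * (1 / 2) ≤ a' * M v := by have := h.a_nonneg; gcongr
  linarith

/-- If the origin has depth at most `√ε` in `K` along `p`, its depth along nearby directions is
governed by a supporting functional. -/
lemma LineEnds.sub_le_mul_support (hK1 : K ⊆ closedBall 0 1) (h0 : (0 : V) ∈ K) (hA : 100 ≤ A)
    (hp : closedBall p (4 / A) ⊆ K) (hs : 0 < s) (hsA : s * A ^ 40 ≤ 1) {a b : ℝ}
    (hab : LineEnds K p a b) (has : a ≤ s) {M : V →ₗ[ℝ] ℝ} (hMp : M p = 1)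
    (hM : ∀ x ∈ K, -a ≤ M x) {F : Submodule ℝ V} {L : V →ₗ[ℝ] EuclideanSpace ℝ (Fin 2)} {x₀ : V}
    (hF : DeepFit K A (s ^ 2) F L x₀) (hpF : p ∈ F) {v : V} (hv : v ∈ F)
    (hvp : v ∈ closedBall p (1 / A)) {a' b' : ℝ} (hv' : LineEnds K v a' b') :
    a - A ^ 8 * s ^ 2 ≤ a' * M v := by
  have hA0 : 0 < A := by linarith
  have hA1 : 1 ≤ A := by linarith
  have hs1 : s ≤ 1 := by
    have : 1 ≤ A ^ 40 := one_le_pow₀ hA1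
    nlinarith
  have hs2 : 0 < s ^ 2 := by positivity
  have hsε : A ^ 3 * s ^ 2 ≤ 1 := by
    have h1 : A ^ 3 * s ≤ 1 := le_trans (by
      rw [mul_comm]; gcongr; norm_num) hsA
    calc _ = A ^ 3 * s * s := by ring
      _ ≤ 1 * 1 := by gcongr
      _ = 1 := one_mul 1
  obtain ⟨σ, hσ0, hσA, -, -, -, hc, hm⟩ := hF.linear_part_close hK1 h0 hA hp hs hsA hab.a_nonneg
    has hMp hM hpF (mem_closedBall_self (by positivity)) hab (ω := 0) (B := A ^ 3)
    (by rw [hMp]; simp) (by positivity) (by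
      rw [add_zero, ← pow_mul]; gcongr; norm_num)
  have hvK := closedBall_subset_of_near hp hvp
  have hvn : ‖v‖ ≤ 1 := by simpa using hK1 (hvK (mem_closedBall_self (by positivity)))
  have ha' : a' ≤ 2 * s :=
    (hv'.le_two_mul hA hp (has.trans hs1) hMp hM hvp).trans (by linarith)
  have ha'0 := hv'.a_nonneg
  have h1 := hF.neg_le_conic_a hK1 hA hs2 hsε hv hvK hv'
  rw [← neg_smul, conic_smul] at h1
  have h2 := mul_le_mul_of_nonneg_left h1 hσ0.le
  have hqv : ‖L v‖ ^ 2 ≤ A ^ 2 := by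
    have := (hF.upper v hv).trans (mul_le_of_le_one_right hA0.le hvn)
    gcongr
  have h3 : σ * (‖L v‖ ^ 2 * (-a') ^ 2) ≤ A ^ 2 * (A ^ 2 * (2 * s) ^ 2) := by
    rw [neg_sq]; gcongr
  have h4 : σ * (A ^ 3 * s ^ 2) ≤ A ^ 2 * (A ^ 3 * s ^ 2) := by gcongr
  have h5 := (abs_le.1 ((hm v hv).trans (mul_le_of_le_one_right (by positivity) hvn))).2
  have h6 : a' * (σ * (2 * inner ℝ (L x₀) (L v)) - M v) ≤ 2 * s * (A ^ 4 * A ^ 3 * s) :=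
    (mul_le_mul_of_nonneg_left h5 ha'0).trans (by gcongr)
  have h7 : A ^ 4 * s ^ 2 ≤ A ^ 7 * s ^ 2 := by gcongr; norm_num
  have h8 : A ^ 5 * s ^ 2 ≤ A ^ 7 * s ^ 2 := by gcongr; norm_num
  have h9 : 100 * (A ^ 7 * s ^ 2) ≤ A * (A ^ 7 * s ^ 2) := by gcongr
  have h10 : 0 ≤ A ^ 7 * s ^ 2 := by positivity
  linarith

lemma exists_common_of_shallow (hK : Convex ℝ K) (hKc : IsCompact K) (hK1 : K ⊆ closedBall 0 1)
    (h0 : (0 : V) ∈ K) (hA : 100 ≤ A) (hp : closedBall p (4 / A) ⊆ K) (hp0 : 8 / A ≤ ‖p‖)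
    (hs : 0 < s) (hsA : s * A ^ 40 ≤ 1)
    (hdeep : ∀ v ∈ closedBall p (1 / A), ∃ F : Submodule ℝ V, ∃ L x₀,
      p ∈ F ∧ v ∈ F ∧ DeepFit K A (s ^ 2) F L x₀)
    {a b : ℝ} (hab : LineEnds K p a b) (has : a ≤ s) :
    ∃ Φ : V → ℝ, ∀ F : Submodule ℝ V, ∀ L x₀, DeepFit K A (s ^ 2) F L x₀ →
      ∀ u ∈ F, u ∈ closedBall p (1 / A) →
      ∃ σ : ℝ, 0 < σ ∧ σ ≤ A ^ 5 ∧ (p ∈ F → 1 ≤ A ^ 5 * σ) ∧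
        ∀ v ∈ F, v ∈ closedBall p (1 / A) → |σ * conic L x₀ v - Φ v| ≤ A ^ 10 * s := by
  have hA0 : 0 < A := by linarith
  have hA1 : 1 ≤ A := by linarith
  have hs1 : s ≤ 1 := by
    have : 1 ≤ A ^ 40 := one_le_pow₀ hA1
    nlinarith
  have hs2 : 0 < s ^ 2 := by positivity
  have hsε : A ^ 3 * s ^ 2 ≤ 1 := by
    have h1 : A ^ 3 * s ≤ 1 := le_trans (by
      rw [mul_comm]; gcongr; norm_num) hsA
    calc _ = A ^ 3 * s * s := by ring
      _ ≤ 1 * 1 := by gcongr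
      _ = 1 := one_mul 1
  have hp0' : p ≠ 0 := by
    rintro rfl
    rw [norm_zero] at hp0
    exact absurd hp0 (not_le.2 (by positivity))
  obtain ⟨M, hMp, hM⟩ := hab.exists_support hK (by positivity) hp hp0'
  have hex : ∀ v : V, ∃ ab : ℝ × ℝ, v ≠ 0 → LineEnds K v ab.1 ab.2 := by
    intro v
    by_cases hv : v = 0
    · exact ⟨0, fun h => absurd hv h⟩
    · obtain ⟨a, b, h⟩ := exists_lineEnds hKc h0 hv
      exact ⟨(a, b), fun _ => h⟩
  choose g hg using hex
  have hends : ∀ v ∈ closedBall p (1 / A), LineEnds K v (g v).1 (g v).2 := by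
    intro v hv
    have h1 := norm_near hp0 hv
    exact hg v (by
      rintro rfl; rw [norm_zero] at h1; exact absurd h1 (not_le.2 (by positivity)))
  refine ⟨fun v => M v * (1 / (g v).2 - 1), ?_⟩
  intro F L x₀ hF u hu hup
  obtain ⟨F', L', x₀', hpF', huF', hF'⟩ := hdeep u hup
  have hω := hab.sub_le_mul_support hK1 h0 hA hp hs hsA has hMp hM hF' hpF' huF' hup
    (hends u hup)
  obtain ⟨σ, hσ0, hσA, hσA', hc0, hcs, -, hm⟩ := hF.linear_part_close hK1 h0 hA hp hs hsA
    hab.a_nonneg has hMp hM hu hup (hends u hup) (B := A ^ 5) hω (by positivity) (by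
      have h1 : 100 * (A ^ 9 * s ^ 2) ≤ A * (A ^ 9 * s ^ 2) := by gcongr
      have h2 : A ^ 5 * s ^ 2 ≤ A ^ 9 * s ^ 2 := by gcongr; norm_num
      have h3 : A ^ 8 * s ^ 2 ≤ A ^ 9 * s ^ 2 := by gcongr; norm_num
      have h4 : 0 ≤ A ^ 9 * s ^ 2 := by positivity
      linarith)
  have h25 : A ^ 2 ≤ A ^ 5 := pow_le_pow_right₀ hA1 (by norm_num)
  refine ⟨σ, hσ0, hσA.trans h25, fun _ => hσA'.trans (by gcongr), ?_⟩
  intro v hv hvp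
  have hvK := closedBall_subset_of_near hp hvp
  have hvmem : v ∈ K := hvK (mem_closedBall_self (by positivity))
  have hvn : ‖v‖ ≤ 1 := by simpa using hK1 hvmem
  have hE := hends v hvp
  have hb1 := hE.one_le hvmem
  have e1 := hF.neg_le_conic_b hK1 hA hs2 hsε hv hvK hE
  have e2 := hF.conic_nonpos _ hE.b_mem (F.smul_mem _ hv)
  have e3 : |σ * conic L x₀ ((g v).2 • v)| ≤ A ^ 2 * (A ^ 3 * s ^ 2) := by
    rw [abs_mul, abs_of_pos hσ0]
    gcongr
    exact abs_le.2 ⟨e1, e2.trans (by positivity)⟩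
  have h1 := abs_quadratic_at_one_sub_le' (q := σ * ‖L v‖ ^ 2)
    (m := σ * (2 * inner ℝ (L x₀) (L v))) (c := -(σ * conic L x₀ 0)) (b := (g v).2)
    (e := σ * conic L x₀ ((g v).2 • v)) hb1 (by rw [conic_smul]; ring)
    ((hm v hv).trans (mul_le_of_le_one_right (by positivity) hvn))
  have h2 : σ * ‖L v‖ ^ 2 - σ * (2 * inner ℝ (L x₀) (L v)) - -(σ * conic L x₀ 0) =
      σ * conic L x₀ v := by
    have := conic_smul L x₀ v 1
    rw [one_smul] at this
    rw [this]; ring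
  rw [h2, abs_of_nonneg hc0] at h1
  refine h1.trans ?_
  have h3 : A ^ 5 * (s * s) ≤ A ^ 5 * (s * 1) := by gcongr
  have h4 : A ^ 5 * s ≤ A ^ 9 * s := by gcongr; norm_num
  have h5 : A ^ 4 * s ≤ A ^ 9 * s := by gcongr; norm_num
  have h6 : 100 * (A ^ 9 * s) ≤ A * (A ^ 9 * s) := by gcongr
  have h7 : 0 ≤ A ^ 9 * s := by positivity
  linarith

/-- All normalised conics fitting the plane sections agree near `p`. -/
lemma exists_common (hK : Convex ℝ K) (hKc : IsCompact K) (hK1 : K ⊆ closedBall 0 1)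
    (h0 : (0 : V) ∈ K) (hA : 100 ≤ A) (hp : closedBall p (4 / A) ⊆ K) (hp0 : 8 / A ≤ ‖p‖)
    (hs : 0 < s) (hsA : s * A ^ 40 ≤ 1)
    (hdeep : ∀ v ∈ closedBall p (1 / A), ∃ F : Submodule ℝ V, ∃ L x₀,
      p ∈ F ∧ v ∈ F ∧ DeepFit K A (s ^ 2) F L x₀) :
    ∃ Φ : V → ℝ, ∀ F : Submodule ℝ V, ∀ L x₀, DeepFit K A (s ^ 2) F L x₀ →
      ∀ u ∈ F, u ∈ closedBall p (1 / A) →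
      ∃ σ : ℝ, 0 < σ ∧ σ ≤ A ^ 5 ∧ (p ∈ F → 1 ≤ A ^ 5 * σ) ∧
        ∀ v ∈ F, v ∈ closedBall p (1 / A) → |σ * conic L x₀ v - Φ v| ≤ A ^ 10 * s := by
  have hA0 : 0 < A := by linarith
  have hp0' : p ≠ 0 := by
    rintro rfl
    rw [norm_zero] at hp0
    exact absurd hp0 (not_le.2 (by positivity))
  obtain ⟨a, b, hab⟩ := exists_lineEnds hKc h0 hp0'
  rcases le_total a s with has | has
  · exact exists_common_of_shallow hK hKc hK1 h0 hA hp hp0 hs hsA hdeep hab has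
  · exact exists_common_of_deep hK hKc hK1 h0 hA hp hp0 hs hsA hab has

end Common

section HyersUlam

/-- The second-order difference of `Ψ` at the origin. -/
def secondDiff {V : Type*} [AddGroup V] (Ψ : V → ℝ) (x y : V) : ℝ := Ψ (x + y) - Ψ x - Ψ y + Ψ 0

lemma secondDiff_comm {V : Type*} [AddCommGroup V] {Ψ : V → ℝ} (x y : V) :
    secondDiff Ψ x y = secondDiff Ψ y x := by
  rw [secondDiff, secondDiff, add_comm x y]; ring

lemma secondDiff_zero_right {V : Type*} [AddGroup V] {Ψ : V → ℝ} (x : V) :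
    secondDiff Ψ x 0 = 0 := by
  rw [secondDiff, add_zero]; ring

/-- The odd part of `Ψ`. -/
noncomputable def oddPart {V : Type*} [AddGroup V] (Ψ : V → ℝ) (x : V) : ℝ := (Ψ x - Ψ (-x)) / 2

variable {V : Type*} [NormedAddCommGroup V] [NormedSpace ℝ V]

/-- `Ψ` is, on the part of every line lying in the ball of radius `4`, within `η` of a quadratic
polynomial. -/
def LineQuadratic (Ψ : V → ℝ) (η : ℝ) : Prop :=
  ∀ x y : V, ∃ α β γ : ℝ, ∀ t : ℝ, ‖x + t • y‖ ≤ 4 → |Ψ (x + t • y) - (α + β * t + γ * t ^ 2)| ≤ η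

variable {Ψ : V → ℝ} {η : ℝ}

lemma LineQuadratic.third_diff (h : LineQuadratic Ψ η) {b a : V} (h0 : ‖b‖ ≤ 4)
    (h1 : ‖b + a‖ ≤ 4) (h2 : ‖b + (2 : ℝ) • a‖ ≤ 4) (h3 : ‖b + (3 : ℝ) • a‖ ≤ 4) :
    |Ψ (b + (3 : ℝ) • a) - 3 * Ψ (b + (2 : ℝ) • a) + 3 * Ψ (b + a) - Ψ b| ≤ 8 * η := by
  obtain ⟨α, β, γ, H⟩ := h b a
  have e0 := H 0 (by simpa using h0)
  have e1 := H 1 (by simpa using h1)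
  have e2 := H 2 h2
  have e3 := H 3 h3
  simp only [zero_smul, one_smul, add_zero] at e0 e1
  rw [abs_le] at *
  constructor <;> linarith

lemma LineQuadratic.third_diff_coord (h : LineQuadratic Ψ η) {x y z : V} (hx : ‖x‖ ≤ 1)
    (hy : ‖y‖ ≤ 1) (hz : ‖z‖ ≤ 1) {r s t : ℝ} (hr : 0 ≤ r) (hr1 : r ≤ 1) (hs : 0 ≤ s)
    (hs1 : s ≤ 1) (ht : 0 ≤ t) (ht1 : t ≤ 1) :
    |Ψ ((-2 * r) • x + (-(s / 2)) • y + (0 : ℝ) • z) - 3 * Ψ ((-r) • x + (0 : ℝ) • y + (t / 3) • z)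
      + 3 * Ψ ((0 : ℝ) • x + (s / 2) • y + (2 * t / 3) • z) - Ψ (r • x + s • y + t • z)|
      ≤ 8 * η := by
  have key : ∀ a b c : ℝ, |a| ≤ 2 → |b| ≤ 1 → |c| ≤ 1 → ‖a • x + b • y + c • z‖ ≤ 4 := by
    intro a b c ha hb hc
    refine (norm_add₃_le).trans ?_
    simp only [norm_smul, Real.norm_eq_abs]
    calc _ ≤ 2 * 1 + 1 * 1 + 1 * (1 : ℝ) := by gcongr
      _ = 4 := by norm_num
  have E1 : (r • x + s • y + t • z) + ((-r) • x + (-(s / 2)) • y + (-(t / 3)) • z) =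
      (0 : ℝ) • x + (s / 2) • y + (2 * t / 3) • z := by module
  have E2 : (r • x + s • y + t • z) + (2 : ℝ) • ((-r) • x + (-(s / 2)) • y + (-(t / 3)) • z) =
      (-r) • x + (0 : ℝ) • y + (t / 3) • z := by module
  have E3 : (r • x + s • y + t • z) + (3 : ℝ) • ((-r) • x + (-(s / 2)) • y + (-(t / 3)) • z) =
      (-2 * r) • x + (-(s / 2)) • y + (0 : ℝ) • z := by module
  have := h.third_diff (b := r • x + s • y + t • z)
    (a := (-r) • x + (-(s / 2)) • y + (-(t / 3)) • z)
    (key _ _ _ (abs_le.2 ⟨by linarith, by linarith⟩) (abs_le.2 ⟨by linarith, by linarith⟩)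
      (abs_le.2 ⟨by linarith, by linarith⟩))
    (by rw [E1]; exact key _ _ _ (abs_le.2 ⟨by linarith, by linarith⟩)
          (abs_le.2 ⟨by linarith, by linarith⟩) (abs_le.2 ⟨by linarith, by linarith⟩))
    (by rw [E2]; exact key _ _ _ (abs_le.2 ⟨by linarith, by linarith⟩)
          (abs_le.2 ⟨by linarith, by linarith⟩) (abs_le.2 ⟨by linarith, by linarith⟩))
    (by rw [E3]; exact key _ _ _ (abs_le.2 ⟨by linarith, by linarith⟩)
          (abs_le.2 ⟨by linarith, by linarith⟩) (abs_le.2 ⟨by linarith, by linarith⟩))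
  rwa [E1, E2, E3] at this

lemma LineQuadratic.secondDiff_add (h : LineQuadratic Ψ η) {x y z : V} (hx : ‖x‖ ≤ 1)
    (hy : ‖y‖ ≤ 1) (hz : ‖z‖ ≤ 1) :
    |secondDiff Ψ x (y + z) - secondDiff Ψ x y - secondDiff Ψ x z| ≤ 64 * η := by
  have H := fun {r s t : ℝ} => h.third_diff_coord hx hy hz (r := r) (s := s) (t := t)
  have i0 : (0 : ℝ) ≤ 0 := le_rfl
  have i1 : (0 : ℝ) ≤ 1 := zero_le_one
  have j1 : (1 : ℝ) ≤ 1 := le_rfl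
  have T000 := H i0 i1 i0 i1 i0 i1
  have T001 := H i0 i1 i0 i1 i1 j1
  have T010 := H i0 i1 i1 j1 i0 i1
  have T011 := H i0 i1 i1 j1 i1 j1
  have T100 := H i1 j1 i0 i1 i0 i1
  have T101 := H i1 j1 i0 i1 i1 j1
  have T110 := H i1 j1 i1 j1 i0 i1
  have T111 := H i1 j1 i1 j1 i1 j1
  simp only [mul_zero, mul_one, neg_zero, zero_div, zero_smul, one_smul, zero_add, add_zero] at *
  rw [secondDiff, secondDiff, secondDiff, ← add_assoc]
  rw [abs_le] at *
  constructor <;> linarith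

lemma LineQuadratic.secondDiff_neg (h : LineQuadratic Ψ η) {x y : V} (hx : ‖x‖ ≤ 1)
    (hy : ‖y‖ ≤ 1) : |secondDiff Ψ x y + secondDiff Ψ x (-y)| ≤ 64 * η := by
  have := h.secondDiff_add hx hy (z := -y) (by rwa [norm_neg])
  rw [add_neg_cancel, secondDiff_zero_right] at this
  rw [abs_le] at *
  constructor <;> linarith

lemma abs_sub_mul_le {ψ : ℝ → ℝ} {α β γ η μ : ℝ} (h0 : ψ 0 = 0)
    (h : ∀ t, |t| ≤ 1 → |ψ t - (α + β * t + γ * t ^ 2)| ≤ η) (h1 : |ψ 1 + ψ (-1)| ≤ μ) {t : ℝ}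
    (ht : |t| ≤ 1) : |ψ t - t * ψ 1| ≤ 8 * η + μ := by
  have e0 := h 0 (by simp)
  have e1 := h 1 (by simp)
  have e2 := h (-1) (by simp)
  have et := h t ht
  rw [h0] at e0
  obtain ⟨t1, t2⟩ := abs_le.1 ht
  have hα : |α| ≤ η := by rw [abs_le] at *; constructor <;> linarith
  have hγ : |γ| ≤ 2 * η + μ / 2 := by
    rw [abs_le] at *; constructor <;> linarith
  have k1 : |α * (1 - t)| ≤ η * 2 := by
    rw [abs_mul]; gcongr
    · exact (abs_nonneg _).trans hα
    · exact abs_le.2 ⟨by linarith, by linarith⟩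
  have k2 : |γ * (t ^ 2 - t)| ≤ (2 * η + μ / 2) * 2 := by
    rw [abs_mul]; gcongr
    · exact (abs_nonneg _).trans hγ
    · exact abs_le.2 ⟨by nlinarith, by nlinarith⟩
  have k3 : |t * (ψ 1 - (α + β * 1 + γ * 1 ^ 2))| ≤ 1 * η := by
    rw [abs_mul]; gcongr
  have : ψ t - t * ψ 1 = (ψ t - (α + β * t + γ * t ^ 2)) + α * (1 - t) + γ * (t ^ 2 - t) -
      t * (ψ 1 - (α + β * 1 + γ * 1 ^ 2)) := by ring
  rw [this]
  rw [abs_le] at *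
  constructor <;> linarith

lemma LineQuadratic.secondDiff_smul (h : LineQuadratic Ψ η) {x y : V} (hx : ‖x‖ ≤ 1)
    (hy : ‖y‖ ≤ 1) {t : ℝ} (ht : |t| ≤ 1) :
    |secondDiff Ψ x (t • y) - t * secondDiff Ψ x y| ≤ 80 * η := by
  obtain ⟨α, β, γ, H⟩ := h x y
  obtain ⟨α', β', γ', H'⟩ := h 0 y
  have hn : ∀ t : ℝ, |t| ≤ 1 → ‖t • y‖ ≤ 1 := by
    intro t ht
    rw [norm_smul, Real.norm_eq_abs]
    exact mul_le_one₀ ht (norm_nonneg _) hy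
  have := abs_sub_mul_le (ψ := fun t => secondDiff Ψ x (t • y)) (η := 2 * η) (μ := 64 * η)
    (α := α - α' - Ψ x + Ψ 0) (β := β - β') (γ := γ - γ')
    (by simp [secondDiff_zero_right]) (by
      intro t ht
      have h1 := H t ((norm_add_le _ _).trans (by linarith [hn t ht]))
      have h2 := H' t (by rw [zero_add]; linarith [hn t ht])
      rw [zero_add] at h2
      simp only [secondDiff]
      rw [abs_le] at *
      constructor <;> linarith)
    (by simpa using h.secondDiff_neg hx hy) ht
  simp only [one_smul] at this
  linarith

lemma LineQuadratic.oddPart_add (h : LineQuadratic Ψ η) {x y : V} (hx : ‖x‖ ≤ 1)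
    (hy : ‖y‖ ≤ 1) : |oddPart Ψ (x + y) - oddPart Ψ x - oddPart Ψ y| ≤ 64 * η := by
  have h1 := h.secondDiff_neg hx hy
  have h2 := h.secondDiff_neg (x := -y) (y := x) (by rwa [norm_neg]) hx
  rw [secondDiff_comm (-y) x, secondDiff_comm (-y) (-x)] at h2
  simp only [oddPart, neg_add]
  simp only [secondDiff] at h1 h2
  rw [abs_le] at *
  constructor <;> linarith

lemma LineQuadratic.oddPart_smul (h : LineQuadratic Ψ η) {y : V}
    (hy : ‖y‖ ≤ 1) {t : ℝ} (ht : |t| ≤ 1) :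
    |oddPart Ψ (t • y) - t * oddPart Ψ y| ≤ 8 * η := by
  obtain ⟨α, β, γ, H⟩ := h 0 y
  simp only [zero_add] at H
  have hn : ∀ t : ℝ, |t| ≤ 1 → ‖t • y‖ ≤ 4 := by
    intro t ht
    rw [norm_smul, Real.norm_eq_abs]
    exact (mul_le_one₀ ht (norm_nonneg _) hy).trans (by norm_num)
  have := abs_sub_mul_le (ψ := fun t => oddPart Ψ (t • y)) (η := η) (μ := 0)
    (α := 0) (β := β) (γ := 0) (by simp [oddPart]) (by
      intro t ht
      have h1 := H t (hn t ht)
      have h2 := H (-t) (hn (-t) (by rwa [abs_neg]))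
      rw [neg_smul] at h2
      simp only [oddPart]
      rw [abs_le] at *
      constructor <;> linarith)
    (by simp only [oddPart, one_smul, neg_smul, neg_neg]; ring_nf; simp) ht
  simp only [one_smul] at this
  linarith

lemma LineQuadratic.sub_oddPart_sub (h : LineQuadratic Ψ η) {x : V} (hx : ‖x‖ ≤ 1) :
    |Ψ x - (Ψ 0 + oddPart Ψ x + secondDiff Ψ x x / 2)| ≤ 32 * η := by
  have h1 := h.secondDiff_neg hx hx
  simp only [oddPart]
  simp only [secondDiff, add_neg_cancel] at h1 ⊢
  rw [abs_le] at *
  constructor <;> linarith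

lemma norm_sum_single_le {n : ℕ} {x : Fin n → ℝ} (hx : ‖x‖ ≤ 1) (s : Finset (Fin n)) :
    ‖∑ i ∈ s, x i • (Pi.single i 1 : Fin n → ℝ)‖ ≤ 1 := by
  rw [pi_norm_le_iff_of_nonneg zero_le_one]
  intro j
  rw [Finset.sum_apply]
  simp only [Pi.smul_apply, Pi.single_apply, smul_eq_mul, mul_ite, mul_one, mul_zero]
  rw [Finset.sum_ite_eq]
  split_ifs
  · exact (norm_le_pi_norm x j).trans hx
  · simp

lemma approx_sum_single {n : ℕ} {f : (Fin n → ℝ) → ℝ} {δ κ : ℝ} (h0 : f 0 = 0)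
    (hf : ∀ u v, ‖u‖ ≤ 1 → ‖v‖ ≤ 1 → |f (u + v) - f u - f v| ≤ δ)
    (hs : ∀ t : ℝ, ∀ i, |t| ≤ 1 → |f (t • (Pi.single i 1 : Fin n → ℝ)) - t * f (Pi.single i 1)| ≤ κ)
    {x : Fin n → ℝ} (hx : ‖x‖ ≤ 1) :
    |f x - ∑ i, x i * f (Pi.single i 1)| ≤ n * (δ + κ) := by
  have key : ∀ s : Finset (Fin n),
      |f (∑ i ∈ s, x i • (Pi.single i 1 : Fin n → ℝ)) - ∑ i ∈ s, x i * f (Pi.single i 1)| ≤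
        s.card * (δ + κ) := by
    intro s
    induction s using Finset.induction_on with
    | empty => simp [h0]
    | insert i s his ih =>
      rw [Finset.sum_insert his, Finset.sum_insert his, Finset.card_insert_of_notMem his]
      have hxi : |x i| ≤ 1 := (norm_le_pi_norm x i).trans hx
      have h1 := hs (x i) i hxi
      have h2 := hf (x i • (Pi.single i 1 : Fin n → ℝ))
        (∑ i ∈ s, x i • (Pi.single i 1 : Fin n → ℝ)) (by
          simpa using norm_sum_single_le hx {i}) (norm_sum_single_le hx s)
      push_cast
      rw [abs_le] at *
      constructor <;> linarith
  have := key Finset.univ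
  rw [Finset.card_univ, Fintype.card_fin] at this
  have e : ∑ i, x i • (Pi.single i 1 : Fin n → ℝ) = x := by
    simpa using (pi_eq_sum_univ' x).symm
  rwa [e] at this

/-- A function that is close to a quadratic polynomial on every line is close to a quadratic
polynomial. -/
theorem LineQuadratic.exists_quadratic {n : ℕ} (hn : 1 ≤ n) {Ψ : (Fin n → ℝ) → ℝ} {η : ℝ}
    (h : LineQuadratic Ψ η) :
    ∃ (M : Matrix (Fin n) (Fin n) ℝ) (l : Fin n → ℝ) (c : ℝ), M.transpose = M ∧
      ∀ x, ‖x‖ ≤ 1 → |Ψ x - (x ⬝ᵥ M.mulVec x + l ⬝ᵥ x + c)| ≤ 1000 * n ^ 2 * η := by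
  have hη : 0 ≤ η := by
    obtain ⟨α, β, γ, H⟩ := h 0 0
    exact (abs_nonneg _).trans (H 0 (by simp))
  have hsingle : ∀ i : Fin n, ‖(Pi.single i 1 : Fin n → ℝ)‖ ≤ 1 := fun i => by
    rw [pi_norm_le_iff_of_nonneg zero_le_one]
    intro j
    rw [Pi.single_apply]
    split_ifs <;> simp
  refine ⟨Matrix.of fun i j => secondDiff Ψ (Pi.single i 1) (Pi.single j 1) / 2,
    fun i => oddPart Ψ (Pi.single i 1), Ψ 0, ?_, ?_⟩
  · ext i j
    rw [Matrix.transpose_apply, Matrix.of_apply, Matrix.of_apply, secondDiff_comm]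
  intro x hx
  have h1 := h.sub_oddPart_sub hx
  have h2 := approx_sum_single (f := oddPart Ψ) (by simp [oddPart])
    (fun u v hu hv => h.oddPart_add hu hv) (fun t i ht => h.oddPart_smul (hsingle i) ht) hx
  have h3 : ∀ y : Fin n → ℝ, ‖y‖ ≤ 1 →
      |secondDiff Ψ y x - ∑ i, x i * secondDiff Ψ y (Pi.single i 1)| ≤ n * (64 * η + 80 * η) :=
    fun y hy => approx_sum_single (f := secondDiff Ψ y) (secondDiff_zero_right y)
      (fun u v hu hv => h.secondDiff_add hy hu hv)
      (fun t i ht => h.secondDiff_smul hy (hsingle i) ht) hx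
  have h4 : |∑ i, x i * (secondDiff Ψ x (Pi.single i 1) -
      ∑ j, x j * secondDiff Ψ (Pi.single i 1) (Pi.single j 1))| ≤
      n * (n * (64 * η + 80 * η)) := by
    refine (Finset.abs_sum_le_sum_abs _ _).trans ?_
    refine (Finset.sum_le_card_nsmul _ _ (n * (64 * η + 80 * η)) ?_).trans ?_
    · intro i _
      rw [abs_mul, secondDiff_comm x]
      have hxi : |x i| ≤ 1 := (norm_le_pi_norm x i).trans hx
      calc _ ≤ 1 * (n * (64 * η + 80 * η)) := by gcongr; exact h3 _ (hsingle i)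
        _ = _ := one_mul _
    · rw [Finset.card_univ, Fintype.card_fin, nsmul_eq_mul]
  have h5 := h3 x hx
  have e1 : (fun i => oddPart Ψ (Pi.single i 1)) ⬝ᵥ x = ∑ i, x i * oddPart Ψ (Pi.single i 1) := by
    rw [dotProduct_comm]; rfl
  have e2 : x ⬝ᵥ Matrix.mulVec
      (Matrix.of fun i j => secondDiff Ψ (Pi.single i 1) (Pi.single j 1) / 2) x =
      (∑ i, x i * ∑ j, x j * secondDiff Ψ (Pi.single i 1) (Pi.single j 1)) / 2 := by
    simp only [dotProduct, Matrix.mulVec, Matrix.of_apply]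
    rw [Finset.sum_div]
    refine Finset.sum_congr rfl fun i _ => ?_
    rw [mul_div_assoc, Finset.sum_div]
    congr 1
    exact Finset.sum_congr rfl fun j _ => by ring
  rw [e1, e2]
  have e3 : ∑ i, x i * (secondDiff Ψ x (Pi.single i 1) -
      ∑ j, x j * secondDiff Ψ (Pi.single i 1) (Pi.single j 1)) =
      ∑ i, x i * secondDiff Ψ x (Pi.single i 1) -
      ∑ i, x i * ∑ j, x j * secondDiff Ψ (Pi.single i 1) (Pi.single j 1) := by
    simp only [mul_sub, Finset.sum_sub_distrib]
  rw [e3] at h4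
  have hn1 : (1 : ℝ) ≤ n := by exact_mod_cast hn
  have k1 : (n : ℝ) * η ≤ n ^ 2 * η := by gcongr; exact le_self_pow₀ hn1 (by norm_num)
  have k2 : η ≤ n * η := le_mul_of_one_le_left hη hn1
  rw [abs_le] at *
  constructor <;> linarith

end HyersUlam

section Gluing

lemma exists_plane_through {V : Type*} [AddCommGroup V] [Module ℝ V]
    (hV : 1 < Module.finrank ℝ V) (a b : V) :
    ∃ F : Submodule ℝ V, Module.finrank ℝ F = 2 ∧ a ∈ F ∧ b ∈ F := by
  have key : ∀ x y : V, LinearIndependent ℝ ![x, y] → ∃ F : Submodule ℝ V,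
      Module.finrank ℝ F = 2 ∧ x ∈ F ∧ y ∈ F := by
    intro x y h
    refine ⟨Submodule.span ℝ (Set.range ![x, y]), ?_, Submodule.subset_span ⟨0, rfl⟩,
      Submodule.subset_span ⟨1, rfl⟩⟩
    rw [finrank_span_eq_card h, Fintype.card_fin]
  by_cases h : LinearIndependent ℝ ![a, b]
  · exact key a b h
  by_cases ha : a = 0
  · subst ha
    by_cases hb : b = 0
    · subst hb
      obtain ⟨x, hx⟩ : ∃ x : V, x ≠ 0 := by
        have := Module.nontrivial_of_finrank_pos (R := ℝ) (M := V) (by omega)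
        exact exists_ne 0
      obtain ⟨y, hy⟩ := exists_linearIndependent_pair_of_one_lt_finrank (R := ℝ) hV hx
      obtain ⟨F, hF, -⟩ := key x y hy
      exact ⟨F, hF, F.zero_mem, F.zero_mem⟩
    · obtain ⟨y, hy⟩ := exists_linearIndependent_pair_of_one_lt_finrank (R := ℝ) hV hb
      obtain ⟨F, hF, hbF, -⟩ := key b y hy
      exact ⟨F, hF, F.zero_mem, hbF⟩
  · rw [LinearIndependent.pair_iff' ha] at h
    push Not at h
    obtain ⟨t, rfl⟩ := h
    obtain ⟨y, hy⟩ := exists_linearIndependent_pair_of_one_lt_finrank (R := ℝ) hV ha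
    obtain ⟨F, hF, haF, -⟩ := key a y hy
    exact ⟨F, hF, haF, F.smul_mem _ haF⟩

lemma abs_quadratic_growth {α β γ η r : ℝ} (hr : 0 ≤ r)
    (h : ∀ t : ℝ, |t| * r ≤ 1 → |α + β * t + γ * t ^ 2| ≤ η) :
    |α + β + γ| ≤ η * (1 + r + 2 * r ^ 2) ∧ (0 < r → |γ| ≤ 2 * η * r ^ 2) := by
  rcases hr.eq_or_lt with rfl | hr
  · simpa using h 1
  have h0 := h 0 (by simp)
  have h1 := h r⁻¹ (by rw [abs_of_pos (by positivity), inv_mul_cancel₀ hr.ne'])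
  have h2 := h (-r⁻¹) (by rw [abs_neg, abs_of_pos (by positivity), inv_mul_cancel₀ hr.ne'])
  have e1 : |β * r⁻¹| ≤ η := by
    rw [abs_le] at *; constructor <;> linarith
  have e2 : |γ * r⁻¹ ^ 2| ≤ 2 * η := by
    rw [abs_le] at *; constructor <;> linarith
  have hβ : |β| ≤ η * r := by
    rw [abs_mul, abs_of_pos (inv_pos.2 hr), ← div_eq_mul_inv, div_le_iff₀ hr] at e1
    exact e1
  have hγ : |γ| ≤ 2 * η * r ^ 2 := by
    rw [abs_mul, abs_of_pos (by positivity : 0 < r⁻¹ ^ 2), inv_pow, ← div_eq_mul_inv,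
      div_le_iff₀ (by positivity)] at e2
    exact e2
  refine ⟨?_, fun _ => hγ⟩
  rw [abs_le] at *; constructor <;> linarith

variable {V : Type*} [NormedAddCommGroup V] [NormedSpace ℝ V] {K : Set V} {A s : ℝ} {p : V}

lemma lineQuadratic_of_common (hV : 1 < Module.finrank ℝ V) (hA : 100 ≤ A)
    {Φ : V → ℝ}
    (hdeep : ∀ F : Submodule ℝ V, Module.finrank ℝ F = 2 → ∀ u ∈ F, u ∈ closedBall p (1 / A) →
      ∃ L x₀, DeepFit K A (s ^ 2) F L x₀)
    (hΦ : ∀ F : Submodule ℝ V, ∀ L x₀, DeepFit K A (s ^ 2) F L x₀ →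
      ∀ u ∈ F, u ∈ closedBall p (1 / A) →
      ∃ σ : ℝ, 0 < σ ∧ σ ≤ A ^ 5 ∧ (p ∈ F → 1 ≤ A ^ 5 * σ) ∧
        ∀ v ∈ F, v ∈ closedBall p (1 / A) → |σ * conic L x₀ v - Φ v| ≤ A ^ 10 * s) :
    LineQuadratic (fun h => Φ (p + (1 / (4 * A)) • h)) (A ^ 10 * s) := by
  have hA0 : 0 < A := by linarith
  have hball : ∀ h : V, ‖h‖ ≤ 4 → p + (1 / (4 * A)) • h ∈ closedBall p (1 / A) := by
    intro h hh
    rw [mem_closedBall, dist_eq_norm, add_sub_cancel_left, norm_smul,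
      Real.norm_of_nonneg (by positivity)]
    calc _ ≤ 1 / (4 * A) * 4 := by gcongr
      _ = _ := by field_simp
  intro x y
  by_cases hex : ∃ t₀ : ℝ, ‖x + t₀ • y‖ ≤ 4
  · obtain ⟨t₀, ht₀⟩ := hex
    obtain ⟨F, hF2, hxF, hyF⟩ := exists_plane_through hV (p + (1 / (4 * A)) • x) y
    have hmem : ∀ t : ℝ, p + (1 / (4 * A)) • (x + t • y) ∈ F := by
      intro t
      have : p + (1 / (4 * A)) • (x + t • y) =
          (p + (1 / (4 * A)) • x) + ((1 / (4 * A)) * t) • y := by module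
      rw [this]
      exact F.add_mem hxF (F.smul_mem _ hyF)
    obtain ⟨L, x₀, hL⟩ := hdeep F hF2 _ (hmem t₀) (hball _ ht₀)
    obtain ⟨σ, -, -, -, hσ⟩ := hΦ F L x₀ hL _ (hmem t₀) (hball _ ht₀)
    refine ⟨σ * conic L x₀ (p + (1 / (4 * A)) • x),
      σ * (2 * inner ℝ (L ((p + (1 / (4 * A)) • x) - x₀)) (L y) * (1 / (4 * A))),
      σ * (‖L y‖ ^ 2 * (1 / (4 * A)) ^ 2), fun t ht => ?_⟩
    have h1 := hσ _ (hmem t) (hball _ ht)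
    rw [abs_sub_comm]
    convert h1 using 3
    have : p + (1 / (4 * A)) • (x + t • y) =
        (p + (1 / (4 * A)) • x) + ((1 / (4 * A)) * t) • y := by module
    rw [this, conic_add L x₀ _ (_ • y), map_smul, inner_smul_right, norm_smul, mul_pow,
      Real.norm_eq_abs, sq_abs]
    ring
  · push Not at hex
    exact ⟨0, 0, 0, fun t ht => absurd ht (not_le.2 (hex t))⟩

/-- The difference between a conic in a plane through `p` and a quadratic polynomial grows at most
quadratically away from the region where it is small. -/
lemma quadratic_sub_conic {n : ℕ} {p : Fin n → ℝ} {M : Matrix (Fin n) (Fin n) ℝ}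
    {l : Fin n → ℝ} {c η ρ σ : ℝ} {L : (Fin n → ℝ) →ₗ[ℝ] EuclideanSpace ℝ (Fin 2)}
    {x₀ h : Fin n → ℝ}
    (H : ∀ t : ℝ, ‖t • h‖ ≤ 1 → |σ * conic L x₀ (p + ρ • (t • h)) -
      ((t • h) ⬝ᵥ M.mulVec (t • h) + l ⬝ᵥ (t • h) + c)| ≤ η) :
    |σ * conic L x₀ (p + ρ • h) - (h ⬝ᵥ M.mulVec h + l ⬝ᵥ h + c)| ≤
      η * (1 + ‖h‖ + 2 * ‖h‖ ^ 2) ∧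
    (h ≠ 0 → |σ * (ρ ^ 2 * ‖L h‖ ^ 2) - h ⬝ᵥ M.mulVec h| ≤ 2 * η * ‖h‖ ^ 2) := by
  have key : ∀ t : ℝ, σ * conic L x₀ (p + ρ • (t • h)) -
      ((t • h) ⬝ᵥ M.mulVec (t • h) + l ⬝ᵥ (t • h) + c) =
      (σ * conic L x₀ p - c) + (σ * (2 * inner ℝ (L (p - x₀)) (L h) * ρ) - l ⬝ᵥ h) * t +
        (σ * (ρ ^ 2 * ‖L h‖ ^ 2) - h ⬝ᵥ M.mulVec h) * t ^ 2 := by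
    intro t
    rw [smul_smul, conic_add, map_smul, inner_smul_right, norm_smul, mul_pow, Real.norm_eq_abs,
      sq_abs, Matrix.mulVec_smul, smul_dotProduct, dotProduct_smul, dotProduct_smul]
    simp only [smul_eq_mul]
    ring
  have := abs_quadratic_growth (norm_nonneg h) (η := η)
    (α := σ * conic L x₀ p - c) (β := σ * (2 * inner ℝ (L (p - x₀)) (L h) * ρ) - l ⬝ᵥ h)
    (γ := σ * (ρ ^ 2 * ‖L h‖ ^ 2) - h ⬝ᵥ M.mulVec h) (by
      intro t ht
      rw [← key]
      exact H t (by rwa [norm_smul, Real.norm_eq_abs]))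
  have k1 := key 1
  rw [one_smul, mul_one, one_pow, mul_one] at k1
  rw [k1]
  exact ⟨this.1, fun h0 => this.2 (norm_pos_iff.2 h0)⟩

end Gluing

section Quadric

lemma le_of_le_growth {A s σ f r η θ : ℝ} (hA : 100 ≤ A) (hs : 0 < s) (hsA : s * A ^ 40 ≤ 1)
    (hσ : 1 ≤ A ^ 5 * σ) (hη : η = 2 * A ^ 12 * s) (hθ : θ = A ^ 4 * η)
    (h1 : σ * f ≤ θ + η * (1 + r + 2 * r ^ 2)) (h2 : r ^ 2 / (128 * A ^ 2) - 2 ≤ f) :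
    f ≤ A ^ 22 * s := by
  have hA0 : 0 < A := by linarith
  have hA1 : 1 ≤ A := by linarith
  by_contra hcon
  push Not at hcon
  have hf : 0 < f := lt_trans (by positivity) hcon
  have hη0 : 0 < η := by rw [hη]; positivity
  have hr : 1 + r + 2 * r ^ 2 ≤ 2 + 3 * r ^ 2 := by nlinarith [sq_nonneg (r - 1)]
  have h3 : f ≤ A ^ 5 * (θ + η * (2 + 3 * r ^ 2)) := by
    calc f ≤ A ^ 5 * σ * f := le_mul_of_one_le_left hf.le hσ
      _ = A ^ 5 * (σ * f) := by ring
      _ ≤ A ^ 5 * (θ + η * (1 + r + 2 * r ^ 2)) := by gcongr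
      _ ≤ _ := by
        have := mul_le_mul_of_nonneg_left hr hη0.le
        have hA5 : 0 ≤ A ^ 5 := by positivity
        exact mul_le_mul_of_nonneg_left (by linarith) hA5
  have h19 : A ^ 19 * s * A ^ 21 ≤ 1 := by
    calc _ = s * A ^ 40 := by ring
      _ ≤ 1 := hsA
  have h21 : A ^ 21 * s * A ^ 19 ≤ 1 := by
    calc _ = s * A ^ 40 := by ring
      _ ≤ 1 := hsA
  have hA19 : 1000000 ≤ A ^ 19 := by
    calc (1000000 : ℝ) ≤ 100 ^ 19 := by norm_num
      _ ≤ A ^ 19 := by gcongr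
  have hA21 : 1000000 ≤ A ^ 21 := by
    calc (1000000 : ℝ) ≤ 100 ^ 21 := by norm_num
      _ ≤ A ^ 21 := by gcongr
  have hA2 : (10000 : ℝ) ≤ A ^ 2 := by
    calc (10000 : ℝ) = 100 ^ 2 := by norm_num
      _ ≤ A ^ 2 := by gcongr
  have k19 : A ^ 19 * s ≤ 1 / 1000000 := by
    have : A ^ 19 * s * 1000000 ≤ 1 := le_trans (by gcongr) h19
    linarith
  have k21 : A ^ 21 * s ≤ 1 / 1000000 := by
    have : A ^ 21 * s * 1000000 ≤ 1 := le_trans (by gcongr) h21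
    linarith
  have k17 : A ^ 17 * s ≤ 1 / 1000000 := le_trans (by gcongr; norm_num) k19
  have h4 : A ^ 5 * (θ + η * (2 + 3 * r ^ 2)) =
      2 * (A ^ 21 * s) + 4 * (A ^ 17 * s) + 6 * (A ^ 19 * s) * (r ^ 2 / A ^ 2) := by
    rw [hθ, hη]; field_simp; ring
  obtain ⟨R, hR⟩ : ∃ R, R = r ^ 2 / A ^ 2 := ⟨_, rfl⟩
  have hR0 : 0 ≤ R := by rw [hR]; positivity
  have h5 : r ^ 2 / (128 * A ^ 2) = R / 128 := by rw [hR]; field_simp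
  rw [h4, ← hR] at h3
  rw [h5] at h2
  have h6 : 6 * (A ^ 19 * s) * R ≤ 6 * (1 / 1000000) * R := by gcongr
  have h7 : R ≤ 512 := by linarith
  have h8 : 6 * (A ^ 19 * s) * R ≤ 6 * (A ^ 19 * s) * 512 := by gcongr
  have h9 : 10000 * (A ^ 19 * s) ≤ A ^ 2 * (A ^ 19 * s) := by gcongr
  have h10 : A ^ 17 * s ≤ A ^ 19 * s := by gcongr; norm_num
  have h11 : 100 * (A ^ 21 * s) ≤ A * (A ^ 21 * s) := by gcongr
  have h12 : 0 < A ^ 21 * s := by positivity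
  linarith

/-- From a point where the conic is nearly nonpositive, contracting to `p` lands in `K`. -/
lemma DeepFit.mem_of_conic_le {V : Type*} [NormedAddCommGroup V] [NormedSpace ℝ V] {K : Set V}
    {A s : ℝ} {p : V} {F : Submodule ℝ V} {L : V →ₗ[ℝ] EuclideanSpace ℝ (Fin 2)} {x₀ : V}
    (hK : Convex ℝ K) (hA : 100 ≤ A) (hs : 0 < s) (hsA : s * A ^ 40 ≤ 1)
    (hF : DeepFit K A (s ^ 2) F L x₀) (hpF : p ∈ F) (hpK : closedBall p (3 / A) ⊆ K)
    {y : V} (hy : y ∈ F) (h : conic L x₀ (p + y) ≤ A ^ 22 * s) :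
    p + (1 + A ^ 24 * s)⁻¹ • y ∈ K := by
  have hA0 : 0 < A := by linarith
  have hA1 : 1 ≤ A := by linarith
  have hpp : p ∈ K := hpK (mem_closedBall_self (by positivity))
  obtain ⟨μ, hμ⟩ : ∃ μ, μ = A ^ 22 * s := ⟨_, rfl⟩
  have hμ0 : 0 < μ := by rw [hμ]; positivity
  rw [← hμ] at h
  obtain ⟨t, ht⟩ : ∃ t, t = (1 + A * μ / 2)⁻¹ := ⟨_, rfl⟩
  have ht0 : 0 < t := by rw [ht]; positivity
  have ht1 : t ≤ 1 := by
    rw [ht]; exact inv_le_one_of_one_le₀ (by linarith [mul_pos hA0 hμ0])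
  have h1 := conic_convex L x₀ p (p + y) (sub_nonneg.2 ht1) ht0.le (by ring)
  have e1 : (1 - t) • p + t • (p + y) = p + t • y := by module
  rw [e1] at h1
  have h2 := hF.deep p hpF hpK
  have h3 : (1 - t) * conic L x₀ p ≤ (1 - t) * (-(2 / A)) := by
    have := sub_nonneg.2 ht1; gcongr
  have h4 : t * conic L x₀ (p + y) ≤ t * μ := by gcongr
  have h5 : (1 - t) * (-(2 / A)) + t * μ = 0 := by
    rw [ht]; field_simp; ring
  have h6 := hF.shrink p hpF hpK (p + t • y) (F.add_mem hpF (F.smul_mem _ hy)) (by linarith)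
  rw [add_sub_cancel_left, smul_smul] at h6
  -- a further contraction stays in `K`
  have e2 : (1 + A * s ^ 2) * (1 + A * μ / 2) ≤ 1 + A ^ 24 * s := by
    have hs2 : A * s ^ 2 ≤ s := by
      have : A * s ≤ 1 := by
        refine le_trans ?_ hsA
        rw [mul_comm]; gcongr; exact le_self_pow₀ hA1 (by norm_num)
      calc _ = A * s * s := by ring
        _ ≤ 1 * s := by gcongr
        _ = s := one_mul s
    have hs1 : s ≤ 1 := by
      have : 1 ≤ A ^ 40 := one_le_pow₀ hA1
      nlinarith
    have h7 : A * s ^ 2 * (A * μ) ≤ 1 * (A * μ) := by gcongr; linarith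
    have h8 : A * μ = A ^ 23 * s := by rw [hμ]; ring
    have h9 : 100 * (A ^ 23 * s) ≤ A * (A ^ 23 * s) := by gcongr
    have h10 : 1 * s ≤ A ^ 23 * s := by gcongr; exact one_le_pow₀ hA1
    linarith
  have hpos : 0 < (1 + A * s ^ 2) * (1 + A * μ / 2) := by positivity
  have hpos' : 0 < 1 + A ^ 24 * s := by positivity
  have h7 := hK.add_smul_mem hpp h6
    (t := (1 + A * s ^ 2) * (1 + A * μ / 2) / (1 + A ^ 24 * s))
    ⟨by positivity, by rw [div_le_one hpos']; exact e2⟩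
  rw [smul_smul] at h7
  convert h7 using 3
  rw [ht]
  field_simp

theorem exists_quadric {n : ℕ} (hn : 2 ≤ n) {K : Set (Fin n → ℝ)} {A s : ℝ} {p : Fin n → ℝ}
    (hK : Convex ℝ K) (hKc : IsCompact K) (hK1 : K ⊆ closedBall 0 1) (h0 : (0 : Fin n → ℝ) ∈ K)
    (hA : 100 ≤ A) (hAn : 100 * (n : ℝ) ^ 2 ≤ A) (hp : closedBall p (4 / A) ⊆ K)
    (hp0 : 8 / A ≤ ‖p‖) (hs : 0 < s) (hsA : s * A ^ 40 ≤ 1)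
    (hplane : ∀ F : Submodule ℝ (Fin n → ℝ), Module.finrank ℝ F = 2 → PlaneFit K (s ^ 2) F) :
    ∃ (M : Matrix (Fin n) (Fin n) ℝ) (l : Fin n → ℝ) (c : ℝ), M.transpose = M ∧
      (∀ y, y ≠ 0 → 0 < y ⬝ᵥ M.mulVec y) ∧
      (∀ x ∈ K, (x - p) ⬝ᵥ M.mulVec (x - p) + l ⬝ᵥ (x - p) + c ≤ 0) ∧
      ∀ y, y ⬝ᵥ M.mulVec y + l ⬝ᵥ y + c ≤ 0 → p + (1 + A ^ 24 * s)⁻¹ • y ∈ K := by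
  have hA0 : 0 < A := by linarith
  have hA1 : 1 ≤ A := by linarith
  have hV : 1 < Module.finrank ℝ (Fin n → ℝ) := by
    rw [Module.finrank_fin_fun]; omega
  have hs1 : s ^ 2 ≤ 1 / 2 := by
    have h1 : (100 : ℝ) ≤ A ^ 40 := hA.trans (le_self_pow₀ hA1 (by norm_num))
    have h2 : s * 100 ≤ 1 := le_trans (by gcongr) hsA
    nlinarith
  have hdeep : ∀ F : Submodule ℝ (Fin n → ℝ), Module.finrank ℝ F = 2 → ∀ u ∈ F,
      u ∈ closedBall p (1 / A) → ∃ L x₀, DeepFit K A (s ^ 2) F L x₀ := fun F hF u hu hup =>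
    (hplane F hF).exists_deepFit hK hK1 hA (by positivity) hs1 hu (closedBall_subset_of_near hp hup)
  obtain ⟨Φ, hΦ⟩ := exists_common hK hKc hK1 h0 hA hp hp0 hs hsA (by
    intro v hv
    obtain ⟨F, hF, hpF, hvF⟩ := exists_plane_through hV p v
    obtain ⟨L, x₀, h⟩ := hdeep F hF v hvF hv
    exact ⟨F, L, x₀, hpF, hvF, h⟩)
  obtain ⟨M, l, c, hM, hP⟩ := (lineQuadratic_of_common hV hA hdeep hΦ).exists_quadratic (by omega)
  obtain ⟨ρ, hρ⟩ : ∃ ρ, ρ = 1 / (4 * A) := ⟨_, rfl⟩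
  obtain ⟨η, hη⟩ : ∃ η, η = 2 * A ^ 12 * s := ⟨_, rfl⟩
  obtain ⟨θ, hθ⟩ : ∃ θ, θ = A ^ 4 * η := ⟨_, rfl⟩
  have hρ0 : 0 < ρ := by rw [hρ]; positivity
  have hη0 : 0 < η := by rw [hη]; positivity
  have hppA : p ∈ closedBall p (1 / A) := mem_closedBall_self (by positivity)
  have hpK := closedBall_subset_of_near hp hppA
  have hpp : p ∈ K := hpK (mem_closedBall_self (by positivity))
  -- comparison with the conic in each plane through `p`
  have hcomp : ∀ h : Fin n → ℝ, ∃ F : Submodule ℝ (Fin n → ℝ), ∃ L x₀, ∃ σ : ℝ,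
      DeepFit K A (s ^ 2) F L x₀ ∧ p ∈ F ∧ h ∈ F ∧ 0 < σ ∧ 1 ≤ A ^ 5 * σ ∧
      |σ * conic L x₀ (p + ρ • h) - (h ⬝ᵥ M.mulVec h + l ⬝ᵥ h + c)| ≤
        η * (1 + ‖h‖ + 2 * ‖h‖ ^ 2) ∧
      (h ≠ 0 → |σ * (ρ ^ 2 * ‖L h‖ ^ 2) - h ⬝ᵥ M.mulVec h| ≤ 2 * η * ‖h‖ ^ 2) := by
    intro h
    obtain ⟨F, hF2, hpF, hhF⟩ := exists_plane_through hV p h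
    obtain ⟨L, x₀, hF⟩ := hdeep F hF2 p hpF hppA
    obtain ⟨σ, hσ0, -, hσA, hσ⟩ := hΦ F L x₀ hF p hpF hppA
    refine ⟨F, L, x₀, σ, hF, hpF, hhF, hσ0, hσA hpF, quadratic_sub_conic ?_⟩
    intro t ht
    have h1 := hP (t • h) ht
    have h2 := hσ (p + ρ • (t • h)) (F.add_mem hpF (F.smul_mem _ (F.smul_mem _ hhF))) (by
      rw [mem_closedBall, dist_eq_norm, add_sub_cancel_left, norm_smul,
        Real.norm_of_nonneg hρ0.le, hρ]
      calc _ ≤ 1 / (4 * A) * 1 := by gcongr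
        _ = 1 / A * (1 / 4) := by field_simp
        _ ≤ 1 / A * 1 := by gcongr; norm_num
        _ = _ := mul_one _)
    rw [← hρ] at h1
    have h3 : 1000 * (n : ℝ) ^ 2 * (A ^ 10 * s) ≤ A ^ 12 * s := by
      calc _ = 10 * (100 * (n : ℝ) ^ 2) * (A ^ 10 * s) := by ring
        _ ≤ A * A * (A ^ 10 * s) := by gcongr; linarith
        _ = _ := by ring
    have h4 : A ^ 10 * s ≤ A ^ 12 * s := by gcongr; norm_num
    rw [hη]
    rw [abs_le] at *
    constructor <;> linarith
  refine ⟨ρ⁻¹ ^ 2 • M, ρ⁻¹ • l, c - θ, ?_, ?_, ?_, ?_⟩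
  · rw [Matrix.transpose_smul, hM]
  · intro y hy
    obtain ⟨F, L, x₀, σ, hF, -, hyF, hσ0, hσA, -, h⟩ := hcomp y
    have h1 := (abs_le.1 (h hy)).2
    have hyn : 0 < ‖y‖ := norm_pos_iff.2 hy
    have h2 : ‖y‖ ^ 2 ≤ 4 * ‖L y‖ ^ 2 := by
      have := hF.lower y hyF
      calc _ ≤ (2 * ‖L y‖) ^ 2 := by gcongr
        _ = _ := by ring
    have h3 : ‖y‖ ^ 2 ≤ A ^ 8 * (σ * (ρ ^ 2 * ‖L y‖ ^ 2)) := by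
      calc _ ≤ 4 * ‖L y‖ ^ 2 * 1 := by rw [mul_one]; exact h2
        _ ≤ 4 * ‖L y‖ ^ 2 * (A ^ 5 * σ) := by gcongr
        _ = 64 * (A ^ 7 * (σ * (ρ ^ 2 * ‖L y‖ ^ 2))) := by rw [hρ]; field_simp; ring
        _ ≤ A * (A ^ 7 * (σ * (ρ ^ 2 * ‖L y‖ ^ 2))) := by gcongr; linarith
        _ = _ := by ring
    have h4 : A ^ 8 * (2 * η * ‖y‖ ^ 2) ≤ 1 / 2 * ‖y‖ ^ 2 := by
      have : A ^ 8 * (2 * η) ≤ 1 / 2 := by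
        have e1 : A ^ 21 * s ≤ 1 := le_trans (by
          rw [mul_comm]; gcongr; norm_num) hsA
        have e2 : 100 * (A ^ 20 * s) ≤ A * (A ^ 20 * s) := by gcongr
        rw [hη]
        linarith
      calc _ = A ^ 8 * (2 * η) * ‖y‖ ^ 2 := by ring
        _ ≤ _ := by gcongr
    have h5 : 0 < ‖y‖ ^ 2 := by positivity
    have h6 : 0 < A ^ 8 * (y ⬝ᵥ M.mulVec y) := by
      have : A ^ 8 * (σ * (ρ ^ 2 * ‖L y‖ ^ 2) - y ⬝ᵥ M.mulVec y) ≤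
        A ^ 8 * (2 * η * ‖y‖ ^ 2) := by gcongr
      linarith
    have h7 : 0 < y ⬝ᵥ M.mulVec y := by
      by_contra hcon
      have := mul_nonpos_of_nonneg_of_nonpos (pow_pos hA0 8).le (not_lt.1 hcon)
      linarith
    rw [Matrix.smul_mulVec, dotProduct_smul, smul_eq_mul]
    positivity
  · intro x hx
    obtain ⟨F, L, x₀, σ, hF, hpF, hhF, hσ0, hσA, h, -⟩ := hcomp (ρ⁻¹ • (x - p))
    rw [smul_smul, mul_inv_cancel₀ hρ0.ne', one_smul, add_sub_cancel] at h
    have hxF : x ∈ F := by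
      have := F.add_mem (F.smul_mem ρ hhF) hpF
      rwa [smul_smul, mul_inv_cancel₀ hρ0.ne', one_smul, sub_add_cancel] at this
    have h1 := (abs_le.1 h).1
    have h2 := mul_nonpos_of_nonneg_of_nonpos hσ0.le (hF.conic_nonpos x hx hxF)
    have h3 : ‖ρ⁻¹ • (x - p)‖ ≤ 8 * A := by
      have e1 : ‖x - p‖ ≤ 2 := by
        have e2 : ‖x‖ ≤ 1 := by simpa using hK1 hx
        have e3 : ‖p‖ ≤ 1 := by simpa using hK1 hpp
        linarith [norm_sub_le x p]
      rw [norm_smul, Real.norm_of_nonneg (by positivity), hρ]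
      simp only [one_div, inv_inv]
      calc _ ≤ 4 * A * 2 := by gcongr
        _ = _ := by ring
    have h4 : η * (1 + ‖ρ⁻¹ • (x - p)‖ + 2 * ‖ρ⁻¹ • (x - p)‖ ^ 2) ≤ θ := by
      calc _ ≤ η * (1 + 8 * A + 2 * (8 * A) ^ 2) := by gcongr
        _ ≤ η * A ^ 4 := by
          gcongr
          have e1 : (100 : ℝ) * 100 ≤ A * A := by gcongr
          have e2 : 10000 * A ^ 2 ≤ A * A * A ^ 2 := by gcongr; linarith
          nlinarith
        _ = θ := by rw [hθ]; ring
    have h5 : (ρ⁻¹ • (x - p)) ⬝ᵥ M.mulVec (ρ⁻¹ • (x - p)) + l ⬝ᵥ (ρ⁻¹ • (x - p)) + c =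
        (x - p) ⬝ᵥ (ρ⁻¹ ^ 2 • M).mulVec (x - p) + (ρ⁻¹ • l) ⬝ᵥ (x - p) + c := by
      simp only [Matrix.smul_mulVec, Matrix.mulVec_smul, smul_dotProduct, dotProduct_smul,
        smul_eq_mul]
      ring
    rw [h5] at h1
    linarith
  · intro y hy
    obtain ⟨F, L, x₀, σ, hF, hpF, hhF, hσ0, hσA, h, -⟩ := hcomp (ρ⁻¹ • y)
    rw [smul_smul, mul_inv_cancel₀ hρ0.ne', one_smul] at h
    have hyF : y ∈ F := by
      have := F.smul_mem ρ hhF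
      rwa [smul_smul, mul_inv_cancel₀ hρ0.ne', one_smul] at this
    have h1 := (abs_le.1 h).2
    have h5 : (ρ⁻¹ • y) ⬝ᵥ M.mulVec (ρ⁻¹ • y) + l ⬝ᵥ (ρ⁻¹ • y) + c =
        y ⬝ᵥ (ρ⁻¹ ^ 2 • M).mulVec y + (ρ⁻¹ • l) ⬝ᵥ y + c := by
      simp only [Matrix.smul_mulVec, Matrix.mulVec_smul, smul_dotProduct, dotProduct_smul,
        smul_eq_mul]
      ring
    rw [h5] at h1
    refine hF.mem_of_conic_le hK hA hs hsA hpF hpK hyF ?_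
    refine le_of_le_growth (r := ‖ρ⁻¹ • y‖) hA hs hsA hσA hη hθ (by linarith) ?_
    have h6 : ‖L (p - x₀)‖ ≤ 1 := conic_nonpos_iff.1 (hF.conic_nonpos p hpp hpF)
    have h7 : ‖ρ⁻¹ • y‖ ^ 2 / (128 * A ^ 2) = ‖y‖ ^ 2 / 8 := by
      rw [norm_smul, Real.norm_of_nonneg (by positivity), hρ]
      field_simp
      ring
    rw [h7, conic, add_sub_right_comm, map_add]
    have h8 := hF.lower y hyF
    have h9 : ‖L y‖ ≤ ‖L (p - x₀) + L y‖ + 1 := by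
      have := norm_sub_le (L (p - x₀) + L y) (L (p - x₀))
      rw [add_sub_cancel_left] at this
      linarith
    have h10 : ‖y‖ ^ 2 ≤ (2 * (‖L (p - x₀) + L y‖ + 1)) ^ 2 := by
      gcongr; linarith
    nlinarith [sq_nonneg (‖L (p - x₀) + L y‖ - 1)]

end Quadric

section Ellipsoid

open Matrix in
/-- The solid bounded by a positive definite quadric with two points is an ellipsoid. -/
lemma exists_affineEquiv_image_closedBall {n : ℕ} {M : Matrix (Fin n) (Fin n) ℝ} {l : Fin n → ℝ}
    {c : ℝ} (hM : M.transpose = M) (hpos : ∀ y, y ≠ 0 → 0 < y ⬝ᵥ M.mulVec y)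
    {y₁ y₂ : Fin n → ℝ} (h12 : y₁ ≠ y₂) (h1 : y₁ ⬝ᵥ M.mulVec y₁ + l ⬝ᵥ y₁ + c ≤ 0)
    (h2 : y₂ ⬝ᵥ M.mulVec y₂ + l ⬝ᵥ y₂ + c ≤ 0) :
    ∃ T : EuclideanSpace ℝ (Fin n) ≃ᵃ[ℝ] (Fin n → ℝ),
      T '' closedBall 0 1 = {y | y ⬝ᵥ M.mulVec y + l ⬝ᵥ y + c ≤ 0} := by
  have hPD : M.PosDef := PosDef.of_dotProduct_mulVec_pos (by simpa [IsHermitian] using hM)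
    (fun y hy => by simpa using hpos y hy)
  obtain ⟨B, hB⟩ : ∃ B : Matrix (Fin n) (Fin n) ℝ, M = B.transpose * B := by
    open scoped MatrixOrder in
    obtain ⟨B, hB⟩ := CStarAlgebra.nonneg_iff_eq_star_mul_self.mp hPD.posSemidef.nonneg
    exact ⟨B, by simpa [star_eq_conjTranspose] using hB⟩
  have hMdet : IsUnit M.det := (isUnit_iff_isUnit_det M).1 hPD.isUnit
  have hBdet : IsUnit B.det := by
    rw [hB, det_mul, det_transpose] at hMdet
    exact isUnit_of_mul_isUnit_left hMdet
  have hq : ∀ y, y ⬝ᵥ M.mulVec y = ‖WithLp.toLp 2 (B.mulVec y)‖ ^ 2 := by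
    intro y
    rw [hB, ← mulVec_mulVec, dotProduct_mulVec, vecMul_transpose, EuclideanSpace.norm_sq_eq]
    simp [dotProduct, sq]
  obtain ⟨y₀, hy₀⟩ : ∃ y₀, M.mulVec y₀ = (-1 / 2 : ℝ) • l :=
    ⟨M⁻¹.mulVec ((-1 / 2 : ℝ) • l), by rw [mulVec_mulVec, mul_nonsing_inv _ hMdet, one_mulVec]⟩
  have hsq : ∀ y, y ⬝ᵥ M.mulVec y + l ⬝ᵥ y + c =
      (y - y₀) ⬝ᵥ M.mulVec (y - y₀) - (y₀ ⬝ᵥ M.mulVec y₀ - c) := by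
    intro y
    have e1 : y₀ ⬝ᵥ M.mulVec y = y ⬝ᵥ M.mulVec y₀ := by
      rw [dotProduct_mulVec, ← mulVec_transpose, hM, dotProduct_comm]
    have e2 : y ⬝ᵥ M.mulVec y₀ = -1 / 2 * (l ⬝ᵥ y) := by
      rw [hy₀, dotProduct_smul, dotProduct_comm, smul_eq_mul]
    rw [mulVec_sub, sub_dotProduct, dotProduct_sub, dotProduct_sub, e1, e2]
    ring
  obtain ⟨ρ, hρ⟩ : ∃ ρ, ρ = y₀ ⬝ᵥ M.mulVec y₀ - c := ⟨_, rfl⟩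
  have hρ0 : 0 < ρ := by
    rw [hsq] at h1 h2
    rw [hρ]
    rcases eq_or_ne y₁ y₀ with rfl | h
    · have := hpos (y₂ - y₁) (sub_ne_zero.2 h12.symm)
      linarith
    · have := hpos (y₁ - y₀) (sub_ne_zero.2 h)
      linarith
  have hr : √ρ ≠ 0 := (Real.sqrt_pos.2 hρ0).ne'
  let S : (Fin n → ℝ) ≃ₗ[ℝ] EuclideanSpace ℝ (Fin n) :=
    (toLinearEquiv' B ((isUnit_iff_isUnit_det B).2 hBdet).invertible).trans
      ((LinearEquiv.smulOfNeZero ℝ (Fin n → ℝ) (√ρ)⁻¹ (inv_ne_zero hr)).trans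
        (WithLp.linearEquiv 2 ℝ (Fin n → ℝ)).symm)
  have hS : ∀ y, ‖S y‖ ^ 2 = (y ⬝ᵥ M.mulVec y) / ρ := by
    intro y
    have : S y = (√ρ)⁻¹ • WithLp.toLp 2 (B.mulVec y) := by
      simp [S]
      rfl
    rw [this, norm_smul, mul_pow, ← hq, norm_inv, inv_pow, Real.norm_eq_abs, sq_abs,
      Real.sq_sqrt hρ0.le]
    field_simp
  refine ⟨S.symm.toAffineEquiv.trans (AffineEquiv.constVAdd ℝ (Fin n → ℝ) y₀), ?_⟩
  ext y
  simp only [mem_image, mem_closedBall_zero_iff, mem_ofPred_eq]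
  rw [hsq, ← hρ]
  have key : ‖S (y - y₀)‖ ≤ 1 ↔ (y - y₀) ⬝ᵥ M.mulVec (y - y₀) - ρ ≤ 0 := by
    rw [← sq_le_one_iff₀ (norm_nonneg _), hS, div_le_one hρ0, sub_nonpos]
  rw [← key]
  constructor
  · rintro ⟨w, hw, rfl⟩
    simpa using hw
  · intro h
    exact ⟨S (y - y₀), h, by simp⟩

theorem exists_ellipsoid_of_normalized {n : ℕ} (hn : 2 ≤ n) {K : Set (Fin n → ℝ)} {A s : ℝ}
    {p : Fin n → ℝ} (hK : Convex ℝ K) (hKc : IsCompact K) (hK1 : K ⊆ closedBall 0 1)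
    (h0 : (0 : Fin n → ℝ) ∈ K) (hA : 100 ≤ A) (hAn : 100 * (n : ℝ) ^ 2 ≤ A)
    (hp : closedBall p (4 / A) ⊆ K) (hp0 : 8 / A ≤ ‖p‖) (hs : 0 < s)
    (hplane : ∀ F : Submodule ℝ (Fin n → ℝ), Module.finrank ℝ F = 2 → PlaneFit K (s ^ 2) F) :
    ∃ T : EuclideanSpace ℝ (Fin n) ≃ᵃ[ℝ] (Fin n → ℝ), K ⊆ T '' closedBall 0 1 ∧
      ∀ x ∈ T '' closedBall 0 1, p + (1 + A ^ 42 * s)⁻¹ • (x - p) ∈ K := by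
  have hA0 : 0 < A := by linarith
  have hA1 : 1 ≤ A := by linarith
  have hpp : p ∈ K := hp (mem_closedBall_self (by positivity))
  rcases le_or_gt (s * A ^ 40) 1 with hsA | hsA
  · obtain ⟨M, l, c, hM, hpos, hin, hout⟩ :=
      exists_quadric hn hK hKc hK1 h0 hA hAn hp hp0 hs hsA hplane
    have hp0' : (0 : Fin n → ℝ) - p ≠ p - p := by
      intro h
      have : p = 0 := by simpa using h
      rw [this, norm_zero] at hp0
      have : 0 < 8 / A := by positivity
      linarith
    obtain ⟨T, hT⟩ := exists_affineEquiv_image_closedBall hM hpos hp0' (hin 0 h0) (hin p hpp)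
    have hTp : (T.trans (AffineEquiv.constVAdd ℝ (Fin n → ℝ) p)) '' closedBall 0 1 =
        {x | (x - p) ⬝ᵥ M.mulVec (x - p) + l ⬝ᵥ (x - p) + c ≤ 0} := by
      rw [AffineEquiv.coe_trans, image_comp, hT]
      ext x
      simp only [mem_image, mem_ofPred_eq, AffineEquiv.constVAdd_apply, vadd_eq_add]
      constructor
      · rintro ⟨y, hy, rfl⟩
        simpa using hy
      · exact fun h => ⟨x - p, h, by simp⟩
    refine ⟨T.trans (AffineEquiv.constVAdd ℝ (Fin n → ℝ) p), ?_, ?_⟩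
    · rw [hTp]; exact hin
    · rw [hTp]
      intro x hx
      have h1 := hout (x - p) hx
      have hle : 1 + A ^ 24 * s ≤ 1 + A ^ 42 * s := by gcongr; norm_num
      have hpos1 : 0 < 1 + A ^ 24 * s := by positivity
      have hpos2 : 0 < 1 + A ^ 42 * s := by positivity
      have h2 := hK.add_smul_mem hpp h1 (t := (1 + A ^ 24 * s) / (1 + A ^ 42 * s))
        ⟨by positivity, by rw [div_le_one hpos2]; exact hle⟩
      rw [smul_smul] at h2
      convert h2 using 3
      field_simp
  · have hn0 : (0 : ℝ) < n := by positivity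
    have hn1 : (2 : ℝ) ≤ n := by exact_mod_cast hn
    let S : EuclideanSpace ℝ (Fin n) ≃ₗ[ℝ] (Fin n → ℝ) :=
      (WithLp.linearEquiv 2 ℝ (Fin n → ℝ)).trans
        (LinearEquiv.smulOfNeZero ℝ (Fin n → ℝ) (2 * n : ℝ) (by positivity))
    have hSa : ∀ w, S w = (2 * n : ℝ) • WithLp.ofLp w := fun w => by
      simp [S]
    refine ⟨S.toAffineEquiv.trans (AffineEquiv.constVAdd ℝ (Fin n → ℝ) p), ?_, ?_⟩
    · intro x hx
      refine ⟨S.symm (x - p), ?_, by simp⟩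
      have h1 : ‖x - p‖ ≤ 2 := by
        have e2 : ‖x‖ ≤ 1 := by simpa using hK1 hx
        have e3 : ‖p‖ ≤ 1 := by simpa using hK1 hpp
        linarith [norm_sub_le x p]
      obtain ⟨w, hw⟩ : ∃ w, w = S.symm (x - p) := ⟨_, rfl⟩
      have hSw : (2 * n : ℝ) • WithLp.ofLp w = x - p := by rw [← hSa, hw, S.apply_symm_apply]
      rw [← hw, mem_closedBall_zero_iff, ← sq_le_one_iff₀ (norm_nonneg _),
        EuclideanSpace.norm_sq_eq]
      have h2 : ∀ i, ‖w i‖ ^ 2 ≤ (1 / n : ℝ) ^ 2 := by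
        intro i
        have h3 : ‖(x - p) i‖ ≤ 2 := (norm_le_pi_norm _ i).trans h1
        rw [← hSw, Pi.smul_apply, norm_smul, Real.norm_of_nonneg (by positivity)] at h3
        gcongr
        rw [le_div_iff₀ hn0]
        linarith
      calc ∑ i, ‖w i‖ ^ 2 ≤ ∑ _i : Fin n, (1 / n : ℝ) ^ 2 := Finset.sum_le_sum fun i _ => h2 i
        _ = 1 / n := by
          rw [Finset.sum_const, Finset.card_univ, Fintype.card_fin, nsmul_eq_mul]; field_simp
        _ ≤ 1 := by rw [div_le_one hn0]; linarith
    · rintro _ ⟨w, hw, rfl⟩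
      rw [mem_closedBall_zero_iff] at hw
      have h1 : ‖WithLp.ofLp w‖ ≤ 1 := by
        rw [pi_norm_le_iff_of_nonneg zero_le_one]
        exact fun i => (PiLp.norm_apply_le w i).trans hw
      apply hp
      rw [mem_closedBall, dist_eq_norm, add_sub_cancel_left, norm_smul,
        Real.norm_of_nonneg (by positivity)]
      have h2 : (S.toAffineEquiv.trans (AffineEquiv.constVAdd ℝ (Fin n → ℝ) p)) w - p =
          (2 * n : ℝ) • WithLp.ofLp w := by
        simp [S]
      rw [h2, norm_smul, Real.norm_of_nonneg (by positivity), inv_mul_le_iff₀ (by positivity)]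
      have h3 : A ^ 2 ≤ A ^ 42 * s := by
        calc A ^ 2 = A ^ 2 * 1 := by ring
          _ ≤ A ^ 2 * (s * A ^ 40) := by gcongr
          _ = _ := by ring
      calc 2 * (n : ℝ) * ‖WithLp.ofLp w‖ ≤ 2 * n * 1 := by gcongr
        _ ≤ A * 4 := by nlinarith
        _ = A ^ 2 * (4 / A) := by field_simp
        _ ≤ (1 + A ^ 42 * s) * (4 / A) := by gcongr; linarith

end Ellipsoid

section Normalization

/-- An Auerbach-type normalization: coordinates in which `K` lies in the unit cube and contains
the standard basis. -/
lemma exists_normalizing_equiv {n : ℕ} {K : Set (EuclideanSpace ℝ (Fin n))} (hKc : IsCompact K)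
    (h0 : 0 ∈ interior K) :
    ∃ Φ : EuclideanSpace ℝ (Fin n) ≃ₗ[ℝ] (Fin n → ℝ), Φ '' K ⊆ closedBall 0 1 ∧
      ∀ i, Pi.single i 1 ∈ Φ '' K := by
  let b := (EuclideanSpace.basisFun (Fin n) ℝ).toBasis
  have hcont : Continuous fun v : Fin n → EuclideanSpace ℝ (Fin n) => |b.det v| := by
    simp only [Module.Basis.det_apply]
    refine continuous_abs.comp (Continuous.matrix_det ?_)
    refine continuous_matrix fun i j => ?_
    simp only [Module.Basis.toMatrix_apply]
    have : Continuous (b.coord i) := LinearMap.continuous_of_finiteDimensional _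
    exact this.comp (continuous_apply j)
  obtain ⟨v, hv, hmax⟩ := (isCompact_univ_pi fun _ : Fin n => hKc).exists_isMaxOn
    ⟨fun _ => 0, fun _ _ => interior_subset h0⟩ hcont.continuousOn
  have hvK : ∀ i, v i ∈ K := fun i => hv i (mem_univ i)
  obtain ⟨r, hr, hrK⟩ := Metric.mem_nhds_iff.1 (mem_interior_iff_mem_nhds.1 h0)
  have hdet : b.det v ≠ 0 := by
    have h1 : |b.det fun i => (r / 2) • b i| ≤ |b.det v| := by
      refine hmax fun i _ => hrK ?_
      rw [mem_ball_zero_iff, norm_smul, Real.norm_of_nonneg (by positivity)]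
      simp only [b, OrthonormalBasis.coe_toBasis, OrthonormalBasis.norm_eq_one]
      linarith
    rw [(b.det).map_smul_univ (fun _ => r / 2) b, b.det_self, smul_eq_mul, mul_one] at h1
    intro h
    rw [h, abs_zero] at h1
    have : 0 < |∏ _i : Fin n, r / 2| := abs_pos.2 (by positivity)
    linarith
  obtain ⟨hli, hsp⟩ := (b.is_basis_iff_det).2 hdet.isUnit
  let e := Module.Basis.mk hli hsp.ge
  refine ⟨e.equivFun, ?_, fun i => ⟨v i, hvK i, ?_⟩⟩
  · rintro _ ⟨x, hx, rfl⟩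
    rw [mem_closedBall_zero_iff, pi_norm_le_iff_of_nonneg zero_le_one]
    intro i
    have h1 := LinearMap.congr_fun (b.det_smul_mk_coord_eq_det_update hli hsp.ge i) x
    have h2 : |b.det (Function.update v i x)| ≤ |b.det v| := by
      refine hmax fun j _ => ?_
      rcases eq_or_ne j i with rfl | hj
      · simpa using hx
      · simpa [Function.update_of_ne hj] using hvK j
    have h3 : b.det v * e.coord i x = b.det (Function.update v i x) := h1
    rw [← h3, abs_mul] at h2
    have h4 : |e.coord i x| ≤ 1 := le_of_mul_le_mul_left (by simpa using h2) (abs_pos.2 hdet)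
    exact h4
  · have : v i = e i := by simp [e]
    rw [this]
    ext j
    simp [Pi.single_apply, eq_comm]

lemma closedBall_subset_of_simplex {n : ℕ} (hn : 2 ≤ n) {K : Set (Fin n → ℝ)} (hK : Convex ℝ K)
    (h0 : (0 : Fin n → ℝ) ∈ K) (h1 : ∀ i, Pi.single i 1 ∈ K) :
    closedBall (fun _ => 1 / ((n : ℝ) + 1)) (4 / (100 * (n : ℝ) ^ 2)) ⊆ K := by
  intro y hy
  have hn1 : (2 : ℝ) ≤ n := by exact_mod_cast hn
  have hsmall : n * (4 / (100 * (n : ℝ) ^ 2)) ≤ 1 / ((n : ℝ) + 1) := by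
    rw [mul_div_assoc', div_le_div_iff₀ (by positivity) (by positivity)]
    nlinarith
  have hsmall' : 4 / (100 * (n : ℝ) ^ 2) ≤ n * (4 / (100 * (n : ℝ) ^ 2)) :=
    le_mul_of_one_le_left (by positivity) (by linarith)
  have hyi : ∀ i, |y i - 1 / ((n : ℝ) + 1)| ≤ 4 / (100 * (n : ℝ) ^ 2) := by
    intro i
    rw [mem_closedBall, dist_eq_norm] at hy
    exact (norm_le_pi_norm (y - fun _ => 1 / ((n : ℝ) + 1)) i).trans hy
  have hy0 : ∀ i, 0 ≤ y i := fun i => by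
    have := (abs_le.1 (hyi i)).1
    linarith
  have hy1 : ∑ i, y i ≤ 1 := by
    calc ∑ i, y i ≤ ∑ _i : Fin n, (1 / ((n : ℝ) + 1) + 4 / (100 * (n : ℝ) ^ 2)) :=
          Finset.sum_le_sum fun i _ => by have := (abs_le.1 (hyi i)).2; linarith
      _ = n * (1 / ((n : ℝ) + 1)) + n * (4 / (100 * (n : ℝ) ^ 2)) := by
          rw [Finset.sum_const, Finset.card_univ, Fintype.card_fin, nsmul_eq_mul]; ring
      _ ≤ n * (1 / ((n : ℝ) + 1)) + 1 / ((n : ℝ) + 1) := by gcongr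
      _ = 1 := by field_simp
  have h2 := hK.sum_mem (t := (Finset.univ : Finset (Option (Fin n))))
    (w := fun o => o.elim (1 - ∑ i, y i) y) (z := fun o => o.elim 0 fun i => Pi.single i 1)
    (by rintro (_ | i) -; exacts [sub_nonneg.2 hy1, hy0 i]) (by simp)
    (by rintro (_ | i) -; exacts [h0, h1 i])
  rw [Fintype.sum_option] at h2
  convert h2 using 1
  ext j
  simp [Finset.sum_apply, Pi.single_apply]

/-- A point that is the limit of the contractions `k ↦ (1 + ε)⁻¹ • (k - z)` lies in `K`. -/
lemma fixedPoint_mem {V : Type*} [NormedAddCommGroup V] [NormedSpace ℝ V] {K : Set V}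
    (hK : IsClosed K) (h0 : (0 : V) ∈ K) {ε : ℝ} (hε : 0 < ε) {z : V}
    (h : ∀ k ∈ K, (1 + ε)⁻¹ • (k - z) ∈ K) : -(ε⁻¹ • z) ∈ K := by
  have h1 : ∀ j : ℕ, -(ε⁻¹ • z) + ((1 + ε)⁻¹) ^ j • (ε⁻¹ • z) ∈ K := by
    intro j
    induction j with
    | zero => simpa using h0
    | succ j ih =>
      convert h _ ih using 1
      rw [smul_sub, smul_add, pow_succ]
      match_scalars
      field_simp
      ring
  have hpos : 0 < 1 + ε := by linarith
  have h2 : Filter.Tendsto (fun j : ℕ => -(ε⁻¹ • z) + ((1 + ε)⁻¹) ^ j • (ε⁻¹ • z)) Filter.atTop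
      (nhds (-(ε⁻¹ • z) + (0 : ℝ) • (ε⁻¹ • z))) :=
    tendsto_const_nhds.add ((tendsto_pow_atTop_nhds_zero_of_lt_one (by positivity)
      (inv_lt_one_of_one_lt₀ (by linarith))).smul_const _)
  rw [zero_smul, add_zero] at h2
  exact hK.mem_of_tendsto h2 (Filter.Eventually.of_forall h1)

lemma planeFit_of_affineEquiv {V : Type*} [NormedAddCommGroup V] [NormedSpace ℝ V] {K : Set V}
    (hK : IsClosed K) (h0 : (0 : V) ∈ K) {ε : ℝ} (hε : 0 < ε) {E : Submodule ℝ V}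
    (T : EuclideanSpace ℝ (Fin 2) ≃ᵃ[ℝ] E) (z : E)
    (hin : (Subtype.val ⁻¹' K : Set E) ⊆ T '' closedBall (0 : EuclideanSpace ℝ (Fin 2)) 1)
    (hout : T '' closedBall (0 : EuclideanSpace ℝ (Fin 2)) 1 ⊆
      (1 + ε) • (Subtype.val ⁻¹' K : Set E) + {z}) : PlaneFit K ε E := by
  have hε1 : 0 < 1 + ε := by linarith
  have hout' : ∀ x : E, ‖T.symm x‖ ≤ 1 → ∃ k : E, (k : V) ∈ K ∧ x = (1 + ε) • k + z := by
    intro x hx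
    have hxT : x ∈ T '' closedBall (0 : EuclideanSpace ℝ (Fin 2)) 1 :=
      ⟨T.symm x, by simpa using hx, T.apply_symm_apply x⟩
    obtain ⟨_, ⟨k, hk, rfl⟩, w, hw, h⟩ := hout hxT
    rw [mem_singleton_iff] at hw
    exact ⟨k, hk, by rw [← h, hw]⟩
  have hin' : ∀ x : E, (x : V) ∈ K → ‖T.symm x‖ ≤ 1 := by
    intro x hx
    obtain ⟨w, hw, rfl⟩ := hin hx
    simpa using hw
  obtain ⟨L, hL⟩ := LinearMap.exists_extend (p := E)
    (T.symm.linear : E →ₗ[ℝ] EuclideanSpace ℝ (Fin 2))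
  have hLT : ∀ x : E, L ((x : V) - T 0) = T.symm x := by
    intro x
    have h1 := LinearMap.congr_fun hL (x - T 0)
    rw [LinearMap.comp_apply, Submodule.subtype_apply, Submodule.coe_sub] at h1
    rw [h1]
    have h2 := T.symm.toAffineMap.linearMap_vsub x (T 0)
    simpa using h2
  have hk₀ : ((-(ε⁻¹ • z) : E) : V) ∈ K := by
    refine fixedPoint_mem (K := (Subtype.val ⁻¹' K : Set E))
      (hK.preimage continuous_subtype_val) (by simpa using h0) hε ?_
    intro k hk
    obtain ⟨k', hk', h⟩ := hout' k (hin' k hk)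
    rw [h, add_sub_cancel_right, smul_smul, inv_mul_cancel₀ hε1.ne', one_smul]
    exact hk'
  refine ⟨L, T 0, _, (T 0).2, hk₀, ?_, ?_⟩
  · intro x hx hxE
    rw [hLT ⟨x, hxE⟩]
    exact hin' _ hx
  · intro x hxE hx
    rw [hLT ⟨x, hxE⟩] at hx
    obtain ⟨k, hk, h⟩ := hout' _ hx
    refine ⟨k, hk, ?_⟩
    have h1 := congrArg Subtype.val h
    simp only [Submodule.coe_add, Submodule.coe_smul] at h1
    rw [h1, Submodule.coe_neg, Submodule.coe_smul, smul_neg, smul_smul, mul_inv_cancel₀ hε.ne',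
      one_smul, sub_neg_eq_add]

lemma PlaneFit.image {V W : Type*} [AddCommGroup V] [Module ℝ V] [AddCommGroup W] [Module ℝ W]
    {K : Set V} {ε : ℝ} (Φ : V ≃ₗ[ℝ] W) {F : Submodule ℝ W}
    (h : PlaneFit K ε (F.comap (Φ : V →ₗ[ℝ] W))) : PlaneFit (Φ '' K) ε F := by
  obtain ⟨L, x₀, k₀, hx₀, hk₀, hin, hout⟩ := h
  refine ⟨L ∘ₗ (Φ.symm : W →ₗ[ℝ] V), Φ x₀, Φ k₀, hx₀, mem_image_of_mem _ hk₀, ?_, ?_⟩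
  · rintro _ ⟨x, hx, rfl⟩ hxF
    simpa using hin x hx hxF
  · intro x hxF hx
    obtain ⟨k, hk, h⟩ := hout (Φ.symm x) (by simpa using hxF) (by simpa using hx)
    refine ⟨Φ k, mem_image_of_mem _ hk, ?_⟩
    rw [← map_smul, ← map_smul, ← map_sub, ← h, Φ.apply_symm_apply]

lemma pow_le_const_mul_pow {n : ℕ} (hn : 1 ≤ n) :
    (100 * (n : ℝ) ^ 2) ^ 42 ≤ 100 ^ 42 * 42 ^ 42 * (n : ℝ) ^ (2 * n ^ 2) := by
  have hn1 : (1 : ℝ) ≤ n := by exact_mod_cast hn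
  rw [mul_pow, mul_assoc]
  gcongr
  rcases le_total 42 (n ^ 2) with h | h
  · calc ((n : ℝ) ^ 2) ^ 42 = 1 * (n : ℝ) ^ (2 * 42) := by rw [← pow_mul, one_mul]
      _ ≤ 42 ^ 42 * (n : ℝ) ^ (2 * n ^ 2) := by gcongr; norm_num
  · have h1 : (n : ℝ) ^ 2 ≤ 42 := by exact_mod_cast h
    calc ((n : ℝ) ^ 2) ^ 42 = ((n : ℝ) ^ 2) ^ 42 * 1 := by rw [mul_one]
      _ ≤ 42 ^ 42 * (n : ℝ) ^ (2 * n ^ 2) := by gcongr; exact one_le_pow₀ hn1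

end Normalization

theorem stmt3 :
    ∃ c : ℝ, 0 < c ∧
      ∀ (n : ℕ), 2 ≤ n →
        ∀ K : Set (EuclideanSpace ℝ (Fin n)),
          IsCompact K → Convex ℝ K → 0 ∈ interior K →
            ∀ ε : ℝ, 0 < ε →
              (∀ E : Submodule ℝ (EuclideanSpace ℝ (Fin n)),
                Module.finrank ℝ E = 2 →
                ∃ (T : EuclideanSpace ℝ (Fin 2) ≃ᵃ[ℝ] E) (z : E),
                  (Subtype.val ⁻¹' K : Set E) ⊆
                      T '' closedBall (0 : EuclideanSpace ℝ (Fin 2)) 1 ∧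
                  T '' closedBall (0 : EuclideanSpace ℝ (Fin 2)) 1 ⊆
                      (1 + ε) • (Subtype.val ⁻¹' K : Set E) + {z}) →
              ∃ (T : EuclideanSpace ℝ (Fin n) ≃ᵃ[ℝ] EuclideanSpace ℝ (Fin n))
                (z : EuclideanSpace ℝ (Fin n)),
                  K ⊆ T '' closedBall (0 : EuclideanSpace ℝ (Fin n)) 1 ∧
                  T '' closedBall (0 : EuclideanSpace ℝ (Fin n)) 1 ⊆
                    (1 + c * (n : ℝ) ^ (2 * n ^ 2) * Real.sqrt ε) • K + {z} := by
  refine ⟨100 ^ 42 * 42 ^ 42, by positivity, fun n hn K hKc hK h0 ε hε hplane => ?_⟩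
  have h0K := interior_subset h0
  have hn1 : (2 : ℝ) ≤ n := by exact_mod_cast hn
  have hs : 0 < √ε := Real.sqrt_pos.2 hε
  obtain ⟨Φ, hΦ1, hΦe⟩ := exists_normalizing_equiv hKc h0
  have hΦK : Convex ℝ (Φ '' K) := hK.is_linear_image Φ.toLinearMap.isLinear
  have hΦ0 : (0 : Fin n → ℝ) ∈ Φ '' K := ⟨0, h0K, map_zero Φ⟩
  have hΦc : IsCompact (Φ '' K) :=
    hKc.image Φ.toLinearMap.continuous_of_finiteDimensional
  have hp := closedBall_subset_of_simplex hn hΦK hΦ0 hΦe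
  obtain ⟨A, hA⟩ : ∃ A, A = 100 * (n : ℝ) ^ 2 := ⟨_, rfl⟩
  obtain ⟨p, hpdef⟩ : ∃ p : Fin n → ℝ, p = fun _ => 1 / ((n : ℝ) + 1) := ⟨_, rfl⟩
  rw [← hA, ← hpdef] at hp
  have hA100 : 100 ≤ A := by rw [hA]; nlinarith
  have hA0 : 0 < A := by linarith
  have hp0 : 8 / A ≤ ‖p‖ := by
    have h1 := norm_le_pi_norm p ⟨0, by omega⟩
    rw [hpdef, Real.norm_of_nonneg (by positivity)] at h1
    rw [hpdef]
    refine le_trans ?_ h1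
    rw [hA, div_le_div_iff₀ (by positivity) (by positivity)]
    nlinarith
  obtain ⟨T, hT1, hT2⟩ := exists_ellipsoid_of_normalized hn hΦK hΦc hΦ1 hΦ0 hA100 hA.ge hp hp0 hs
    (by
      intro F hF
      rw [Real.sq_sqrt hε.le]
      refine PlaneFit.image Φ ?_
      obtain ⟨T, z, hin, hout⟩ := hplane (F.comap (Φ : _ →ₗ[ℝ] (Fin n → ℝ))) (by
        rw [Submodule.comap_equiv_eq_map_symm, LinearEquiv.finrank_map_eq, hF])
      exact planeFit_of_affineEquiv hKc.isClosed h0K hε T z hin hout)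
  obtain ⟨Λ, hΛ⟩ : ∃ Λ, Λ = 1 + 100 ^ 42 * 42 ^ 42 * (n : ℝ) ^ (2 * n ^ 2) * √ε := ⟨_, rfl⟩
  have hle : 1 + A ^ 42 * √ε ≤ Λ := by
    rw [hΛ, hA]
    have := pow_le_const_mul_pow (n := n) (by omega)
    gcongr
  have hpos : 0 < 1 + A ^ 42 * √ε := by positivity
  have hΛ0 : 0 < Λ := hpos.trans_le hle
  obtain ⟨q, hq, hqp⟩ := hp (mem_closedBall_self (by positivity))
  rw [← hΛ]
  refine ⟨T.trans Φ.symm.toAffineEquiv, (1 - Λ) • q, ?_, ?_⟩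
  · intro x hx
    obtain ⟨w, hw, h⟩ := hT1 (mem_image_of_mem Φ hx)
    exact ⟨w, hw, by simp [h]⟩
  · rintro _ ⟨w, hw, rfl⟩
    obtain ⟨k, hk, h⟩ := hT2 (T w) (mem_image_of_mem T hw)
    have h1 : Φ.symm (T w) = (1 + A ^ 42 * √ε) • k + (1 - (1 + A ^ 42 * √ε)) • q := by
      rw [LinearEquiv.symm_apply_eq, map_add, map_smul, map_smul, h, hqp, smul_add, smul_smul,
        mul_inv_cancel₀ hpos.ne']
      module
    have h2 := hK.add_smul_sub_mem hq hk (t := (1 + A ^ 42 * √ε) / Λ)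
      ⟨by positivity, by rw [div_le_one hΛ0]; exact hle⟩
    refine ⟨_, smul_mem_smul_set h2, _, rfl, ?_⟩
    have h3 : (T.trans Φ.symm.toAffineEquiv) w = Φ.symm (T w) := rfl
    rw [h3, h1]
    simp only [smul_add, smul_smul, mul_div_cancel₀ _ hΛ0.ne']
    module
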